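/- arXiv:2012.12460 — 2 statements merged into one kernel-verified Lean document; each statement's English description precedes it below -/
import Mathlib

section
/- Let n > 4 and 2 ≤ r ≤ n−2, and let H = C(n,r+1;r) be the set of (r+1)-cycles in S_n moving every point of {1,…,r}. Let G = S_n if r is odd and G = A_n if r is even, and let Γ = Cay(G,H). Then λ1(Γ) = r!·(n−r) and λ2(Γ) = r!·(n−r−1). -/
open Equiv

/-- The Cayley graph of a subset `H` of a group `G`. -/
def cayleyGraph {G : Type*} [Group G] (H : Set G) : SimpleGraph G :=
  SimpleGraph.fromRel (fun u v => u * v⁻¹ ∈ H)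

/-- The set of (real) eigenvalues of a finite graph. -/
noncomputable def graphEigs {V : Type*} [Finite V] (Γ : SimpleGraph V) : Set ℝ := by
  classical
  letI : Fintype V := Fintype.ofFinite V
  exact spectrum ℝ (Γ.adjMatrix ℝ)

/-- `C(n,k;r)`: the set of `k`-cycles in `S_n` moving every point of `{1,…,r}`
(identified with the first `r` elements of `Fin n`). -/
def movingCycles (n k r : ℕ) : Set (Perm (Fin n)) :=
  {g : Perm (Fin n) | g.IsCycle ∧ g.support.card = k ∧
    ∀ i : Fin n, (i : ℕ) < r → i ∈ g.support}

/-- `C(n,k;r)` viewed inside the alternating group `A_n`. -/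
def movingCyclesAlt (n k r : ℕ) : Set (alternatingGroup (Fin n)) :=
  {g : alternatingGroup (Fin n) | (g : Perm (Fin n)).IsCycle ∧
    (g : Perm (Fin n)).support.card = k ∧
    ∀ i : Fin n, (i : ℕ) < r → i ∈ (g : Perm (Fin n)).support}

/-- The image of the sum of the star transpositions `(i x)`, `i ∈ S`, under `ρ`. -/
noncomputable def starSum {α V : Type*} [DecidableEq α] [AddCommGroup V] [Module ℝ V]
    (ρ : Perm α →* Module.End ℝ V) (S : Finset α) (x : α) : Module.End ℝ V :=
  ∑ i ∈ S, ρ (swap i x)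

open Classical in
/-- The image of the sum of all cycles with support `S` under `ρ`. -/
noncomputable def cycleSum {α V : Type*} [Fintype α] [DecidableEq α] [AddCommGroup V] [Module ℝ V]
    (ρ : Perm α →* Module.End ℝ V) (S : Finset α) : Module.End ℝ V :=
  ∑ g : Perm α with g.IsCycle ∧ g.support = S, ρ g

/-- The vector `v` is fixed by all transpositions of points of `S`. -/
def SwapFixed {α V : Type*} [DecidableEq α] [AddCommGroup V] [Module ℝ V]
    (ρ : Perm α →* Module.End ℝ V) (S : Finset α) (v : V) : Prop :=
  ∀ i ∈ S, ∀ j ∈ S, ρ (swap i j) v = v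

section Cycles

variable {α : Type*} [DecidableEq α]

section Fintype

variable [Fintype α]

lemma isCycle_swap_mul {S : Finset α} {x i : α} (hx : x ∉ S) {g : Perm α} (hg : g.IsCycle)
    (hgS : g.support = S) (hi : i ∈ S) :
    (swap i x * g).IsCycle ∧ (swap i x * g).support = insert x S := by
  have hi' : i ∈ g.support := hgS ▸ hi
  have h1 : (g.toList i).formPerm = g := by
    rw [Perm.formPerm_toList, hg.cycleOf_eq (Perm.mem_support.1 hi')]
  have hmem : ∀ y, y ∈ g.toList i ↔ y ∈ S := by
    intro y
    rw [Perm.mem_toList_iff, ← hgS]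
    constructor
    · rintro ⟨h, -⟩
      exact (h.mem_support_iff).1 hi'
    · intro hy
      exact ⟨hg.sameCycle (Perm.mem_support.1 hi') (Perm.mem_support.1 hy), hi'⟩
  have hnd : (g.toList i).Nodup := Perm.nodup_toList g i
  have hget : (g.toList i)[0]? = some i := by
    rw [List.getElem?_eq_getElem (Perm.length_toList_pos_of_mem_support _ _ hi'),
      Perm.toList_getElem_zero g i hi']
  generalize g.toList i = l at *
  match l with
  | [] => simp at hget
  | y :: t =>
    simp only [List.getElem?_cons_zero, Option.some.injEq] at hget
    subst hget
    have hnd' : (x :: y :: t).Nodup := List.nodup_cons.2 ⟨fun h => hx ((hmem x).1 h), hnd⟩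
    have heq : swap y x * g = (x :: y :: t).formPerm := by
      rw [List.formPerm_cons_cons, h1, swap_comm]
    rw [heq]
    refine ⟨List.isCycle_formPerm hnd' (by simp), ?_⟩
    rw [List.support_formPerm_of_nodup _ hnd' (by simp)]
    ext z
    simp only [List.mem_toFinset, Finset.mem_insert, ← hmem, List.mem_cons]

lemma swap_mul_isCycle {S : Finset α} {x : α} (hx : x ∉ S) (hS : 2 ≤ S.card) {h : Perm α}
    (hh : h.IsCycle) (hhS : h.support = insert x S) :
    h x ∈ S ∧ (swap (h x) x * h).IsCycle ∧ (swap (h x) x * h).support = S := by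
  have hxs : x ∈ h.support := by rw [hhS]; simp
  have hhx : h x ≠ x := Perm.mem_support.1 hxs
  have hhxS : h x ∈ S := by
    have : h x ∈ h.support := Perm.apply_mem_support.2 hxs
    rw [hhS, Finset.mem_insert] at this
    exact this.resolve_left hhx
  have hhh : h (h x) ≠ x := by
    intro hc
    have := (hh.eq_swap_of_apply_apply_eq_self hhx hc)
    have hcard := congrArg (fun g => (Perm.support g).card) this
    simp only [hhS, Finset.card_insert_of_notMem hx, Perm.card_support_swap (Ne.symm hhx)] at hcard
    omega
  refine ⟨hhxS, ?_, ?_⟩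
  · rw [swap_comm]; exact hh.swap_mul hhx hhh
  · rw [swap_comm, Perm.support_swap_mul_eq _ _ hhh, hhS]
    ext z
    simp only [Finset.mem_sdiff, Finset.mem_insert, Finset.mem_singleton]
    constructor
    · rintro ⟨h1 | h1, h2⟩ <;> tauto
    · intro hz; exact ⟨Or.inr hz, fun h => hx (h ▸ hz)⟩

lemma cycleSum_insert {V : Type*} [AddCommGroup V] [Module ℝ V] (ρ : Perm α →* Module.End ℝ V)
    {S : Finset α} {x : α} (hx : x ∉ S) (hS : 2 ≤ S.card) :
    cycleSum ρ (insert x S) = starSum ρ S x * cycleSum ρ S := by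
  classical
  unfold cycleSum starSum
  rw [Finset.sum_mul_sum, ← Finset.sum_product']
  symm
  refine Finset.sum_bij' (fun p _ => swap p.1 x * p.2) (fun h _ => (h x, swap (h x) x * h))
    ?_ ?_ ?_ ?_ ?_
  · rintro ⟨i, g⟩ h
    simp only [Finset.mem_product, Finset.mem_filter, Finset.mem_univ, true_and] at h ⊢
    exact isCycle_swap_mul hx h.2.1 h.2.2 h.1
  · intro h hh
    simp only [Finset.mem_product, Finset.mem_filter, Finset.mem_univ, true_and] at hh ⊢
    exact swap_mul_isCycle hx hS hh.1 hh.2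
  · rintro ⟨i, g⟩ h
    simp only [Finset.mem_product, Finset.mem_filter, Finset.mem_univ, true_and] at h ⊢
    have hgx : g x = x := by
      rw [← Perm.notMem_support, h.2.2]; exact hx
    simp [hgx, ← mul_assoc]
  · intro h _
    simp [← mul_assoc]
  · rintro ⟨i, g⟩ _
    simp [map_mul]

lemma cycleSum_pair {V : Type*} [AddCommGroup V] [Module ℝ V] (ρ : Perm α →* Module.End ℝ V)
    {x y : α} (hxy : x ≠ y) : cycleSum ρ {x, y} = ρ (swap x y) := by
  classical
  unfold cycleSum
  rw [Finset.sum_eq_single_of_mem (swap x y)]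
  · simp [Perm.isCycle_swap hxy, Perm.support_swap hxy]
  · intro g hg hne
    exfalso
    simp only [Finset.mem_filter, Finset.mem_univ, true_and] at hg
    apply hne
    have hs : g.IsSwap := by
      rw [← Perm.card_support_eq_two, hg.2, Finset.card_pair hxy]
    obtain ⟨a, b, hab, rfl⟩ := hs
    have h2 := hg.2
    rw [Perm.support_swap hab] at h2
    have ha : a = x ∨ a = y := by
      have : a ∈ ({a, b} : Finset α) := by simp
      simpa [h2] using this
    have hb : b = x ∨ b = y := by
      have : b ∈ ({a, b} : Finset α) := by simp
      simpa [h2] using this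
    rcases ha with rfl | rfl <;> rcases hb with rfl | rfl
    · exact absurd rfl hab
    · rfl
    · exact swap_comm _ _
    · exact absurd rfl hab

end Fintype

variable {V : Type*} [AddCommGroup V] [Module ℝ V] (ρ : Perm α →* Module.End ℝ V)

lemma map_swap_self_apply (x : α) (v : V) : ρ (swap x x) v = v := by
  rw [swap_self]
  exact congrArg (fun f : Module.End ℝ V => f v) (map_one ρ)

lemma commute_starSum {S : Finset α} {x : α} {g : Perm α} (hgx : g x = x)
    (hgS : ∀ i, g i ∈ S ↔ i ∈ S) : Commute (ρ g) (starSum ρ S x) := by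
  unfold starSum Commute SemiconjBy
  rw [Finset.mul_sum, Finset.sum_mul]
  refine Finset.sum_bij' (fun i _ => g i) (fun i _ => g⁻¹ i) ?_ ?_ ?_ ?_ ?_
  · intro i hi; exact (hgS i).2 hi
  · intro i hi; exact (hgS _).1 (by simpa using hi)
  · simp
  · simp
  · intro i _
    rw [← map_mul, ← map_mul]
    congr 1
    rw [mul_swap_eq_swap_mul, hgx]

lemma starSum_commute_starSum {S S' : Finset α} {x y : α} (hS : insert y S ⊆ S') (hx : x ∉ S') :
    Commute (starSum ρ S y) (starSum ρ S' x) := by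
  rw [starSum]
  refine Commute.sum_left _ _ _ fun i hi => commute_starSum ρ ?_ ?_
  · apply swap_apply_of_ne_of_ne
    · rintro rfl; exact hx (hS (by simp [hi]))
    · rintro rfl; exact hx (hS (by simp))
  · intro j
    have h1 : i ∈ S' := hS (by simp [hi])
    have h2 : y ∈ S' := hS (by simp)
    rcases eq_or_ne j i with rfl | h
    · simp [h1, h2]
    rcases eq_or_ne j y with rfl | h'
    · simp [h1, h2]
    · rw [swap_apply_of_ne_of_ne h h']

lemma starSum_insert_eq {S : Finset α} {x y : α} (hx : x ∉ insert y S) (hy : y ∉ S) :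
    starSum ρ (insert y S) x =
      ρ (swap y x) * starSum ρ S y * ρ (swap y x) + ρ (swap y x) := by
  unfold starSum
  rw [Finset.sum_insert hy, add_comm, Finset.mul_sum, Finset.sum_mul]
  congr 1
  refine Finset.sum_congr rfl fun i hi => ?_
  rw [← map_mul, ← map_mul]
  congr 1
  have hiy : i ≠ y := fun h => hy (h ▸ hi)
  have hix : i ≠ x := fun h => hx (by simp [← h, hi])
  have h := mul_swap_eq_swap_mul (swap y x) i y
  rw [h, mul_assoc, swap_mul_self, mul_one, swap_apply_of_ne_of_ne hiy hix, swap_apply_left]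

lemma SwapFixed.mono {S S' : Finset α} {v : V} (h : SwapFixed ρ S v) (hS : S' ⊆ S) :
    SwapFixed ρ S' v := fun i hi j hj => h i (hS hi) j (hS hj)

lemma SwapFixed.insert_of_star {S : Finset α} {x : α} {v : V} (h : ∀ i ∈ S, ρ (swap i x) v = v) :
    SwapFixed ρ (insert x S) v := by
  intro i hi j hj
  rw [Finset.mem_insert] at hi hj
  rcases hi with rfl | hi
  · rcases hj with rfl | hj
    · exact map_swap_self_apply ρ _ _
    · rw [swap_comm]; exact h j hj
  · rcases hj with rfl | hj
    · exact h i hi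
    · rcases eq_or_ne i x with rfl | hix
      · rw [swap_comm]; exact h j hj
      rcases eq_or_ne j i with rfl | hji
      · exact map_swap_self_apply ρ _ _
      rcases eq_or_ne j x with rfl | hjx
      · exact h i hi
      have : swap i j = swap i x * swap j x * swap i x := by
        have h2 := mul_swap_eq_swap_mul (swap i x) j x
        rw [h2, mul_assoc, swap_mul_self, mul_one, swap_apply_of_ne_of_ne hji hjx,
          swap_apply_right, swap_comm]
      rw [this, map_mul, map_mul, Module.End.mul_apply, Module.End.mul_apply, h i hi, h j hj,
        h i hi]

lemma SwapFixed.starSum_apply {S S' : Finset α} {x : α} {v : V} (h : SwapFixed ρ S' v)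
    (hS : S ⊆ S') (hx : x ∈ S') : starSum ρ S x v = (S.card : ℝ) • v := by
  unfold starSum
  rw [LinearMap.sum_apply, Finset.sum_congr rfl (fun i hi => h i (hS hi) x hx),
    Finset.sum_const, Nat.cast_smul_eq_nsmul]

/-- On vectors fixed by the symmetric group of `S`, the operator `J = starSum ρ S x` satisfies
`J² = |S| + (|S| - 1) J`. -/
lemma SwapFixed.starSum_starSum {S : Finset α} {x : α} {v : V} (h : SwapFixed ρ S v)
    (hx : x ∉ S) : starSum ρ S x (starSum ρ S x v) =
      (S.card : ℝ) • v + ((S.card : ℝ) - 1) • starSum ρ S x v := by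
  have key : ∀ i ∈ S, ∀ j ∈ S, ρ (swap i x) (ρ (swap j x) v) =
      if i = j then v else ρ (swap j x) v := by
    intro i hi j hj
    split_ifs with hij
    · subst hij
      rw [← Module.End.mul_apply, ← map_mul, swap_mul_self, map_one, Module.End.one_apply]
    · have hix : i ≠ x := fun h => hx (h ▸ hi)
      have h2 := mul_swap_eq_swap_mul (swap j x) i j
      have hji : (swap i x * swap j x : Perm α) = swap j x * swap i j := by
        rw [h2, swap_apply_of_ne_of_ne hij hix, swap_apply_left]
      rw [← Module.End.mul_apply, ← map_mul, hji, map_mul, Module.End.mul_apply, h i hi j hj]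
  have e1 : starSum ρ S x (starSum ρ S x v) =
      ∑ j ∈ S, ∑ i ∈ S, (if i = j then v else ρ (swap j x) v) := by
    conv_lhs => unfold starSum
    rw [LinearMap.sum_apply, Finset.sum_comm]
    refine Finset.sum_congr rfl fun i hi => ?_
    rw [LinearMap.sum_apply, map_sum]
    exact Finset.sum_congr rfl fun j hj => key i hi j hj
  have e2 : ∀ j ∈ S, ∑ i ∈ S, (if i = j then v else ρ (swap j x) v) =
      v + ((S.card : ℝ) - 1) • ρ (swap j x) v := by
    intro j hj
    rw [← Finset.add_sum_erase _ _ hj, if_pos rfl,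
      Finset.sum_congr rfl (fun i hi => if_neg (Finset.ne_of_mem_erase hi)), Finset.sum_const,
      Finset.card_erase_of_mem hj, ← Nat.cast_smul_eq_nsmul ℝ,
      Nat.cast_sub (Finset.card_pos.2 ⟨j, hj⟩), Nat.cast_one]
  rw [e1, Finset.sum_congr rfl e2, Finset.sum_add_distrib, Finset.sum_const, ← Finset.smul_sum,
    Nat.cast_smul_eq_nsmul, starSum, LinearMap.sum_apply]

end Cycles

section JointEigenvectors

variable {V : Type*} [NormedAddCommGroup V] [InnerProductSpace ℝ V] [FiniteDimensional ℝ V]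

open scoped InnerProductSpace

lemma exists_joint_eigenvector {ι : Type*} [Finite ι] {T : ι → Module.End ℝ V}
    (hT : ∀ i, (T i).IsSymmetric) (hC : Pairwise (Function.onFun Commute T)) {v : V}
    (hv : v ≠ 0) : ∃ (w : V) (χ : ι → ℝ), (∀ i, T i w = χ i • w) ∧ ⟪v, w⟫_ℝ ≠ 0 := by
  classical
  by_contra! hcon
  have htop := LinearMap.IsSymmetric.iSup_iInf_eq_top_of_commute hT hC
  have hle : (⨆ χ : ι → ℝ, ⨅ i, Module.End.eigenspace (T i) (χ i)) ≤ (ℝ ∙ v)ᗮ := by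
    refine iSup_le fun χ w hw => ?_
    rw [Submodule.mem_orthogonal_singleton_iff_inner_right]
    refine hcon w χ fun i => ?_
    exact Module.End.mem_eigenspace_iff.1 ((Submodule.mem_iInf _).1 hw i)
  rw [htop] at hle
  have : v ∈ (ℝ ∙ v)ᗮ := hle trivial
  rw [Submodule.mem_orthogonal_singleton_iff_inner_right] at this
  exact hv (inner_self_eq_zero.1 this)

/-- An eigenvector of `B` is not orthogonal to some eigenvector of `B` with the same eigenvalue
that is a joint eigenvector of a family commuting with `B`. -/
lemma exists_joint_eigenvector_of_commute {ι : Type*} [Finite ι] {T : ι → Module.End ℝ V}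
    {B : Module.End ℝ V} (hT : ∀ i, (T i).IsSymmetric) (hB : B.IsSymmetric)
    (hC : ∀ i j, i ≠ j → Commute (T i) (T j)) (hCB : ∀ i, Commute (T i) B) {v : V} (hv : v ≠ 0)
    {b : ℝ} (hb : B v = b • v) :
    ∃ (w : V) (χ : ι → ℝ), w ≠ 0 ∧ B w = b • w ∧ ∀ i, T i w = χ i • w := by
  have hsymm : ∀ o : Option ι, (o.elim B T).IsSymmetric := by
    rintro (_ | i)
    exacts [hB, hT i]
  have hcomm : Pairwise (Function.onFun Commute fun o : Option ι => o.elim B T) := by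
    rintro (_ | i) (_ | j) hij
    · exact absurd rfl hij
    · exact (hCB j).symm
    · exact hCB i
    · exact hC i j fun h => hij (by rw [h])
  obtain ⟨w, χ, hw, hvw⟩ := exists_joint_eigenvector hsymm hcomm hv
  have hBw : B w = χ none • w := hw none
  have heq : b * ⟪v, w⟫_ℝ = χ none * ⟪v, w⟫_ℝ := by
    rw [← real_inner_smul_left, ← hb, hB v w, hBw, real_inner_smul_right]
  have hbχ := mul_right_cancel₀ hvw heq
  refine ⟨w, fun i => χ (some i), ?_, by rw [hbχ, hBw], fun i => hw (some i)⟩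
  rintro rfl
  exact hvw (inner_zero_right v)

/-- If every eigenvector of `L` with eigenvalue larger than `c` is orthogonal to `v`, then the
quadratic form of `L` at `v` is at most `c ‖v‖²`. -/
lemma inner_le_of_eigenvalues {L : Module.End ℝ V} (hL : L.IsSymmetric) {c : ℝ} {v : V}
    (h : ∀ (w : V) (μ : ℝ), w ≠ 0 → L w = μ • w → μ ≤ c ∨ ⟪v, w⟫_ℝ = 0) :
    ⟪L v, v⟫_ℝ ≤ c * ⟪v, v⟫_ℝ := by
  let b := hL.eigenvectorBasis rfl
  have hb : ∀ i, L (b i) = hL.eigenvalues rfl i • b i := fun i =>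
    hL.apply_eigenvectorBasis rfl i
  rw [← b.sum_inner_mul_inner (L v) v, ← b.sum_inner_mul_inner v v, Finset.mul_sum]
  refine Finset.sum_le_sum fun i _ => ?_
  rw [hL v (b i), hb i, real_inner_smul_right, real_inner_comm v (b i)]
  have hne : b i ≠ 0 := b.orthonormal.ne_zero i
  rcases h (b i) _ hne (hb i) with h1 | h1
  · nlinarith [mul_self_nonneg ⟪v, b i⟫_ℝ]
  · rw [h1]; simp

end JointEigenvectors

section Orthogonal

open scoped InnerProductSpace

variable {α : Type*} [DecidableEq α] {V : Type*} [NormedAddCommGroup V] [InnerProductSpace ℝ V]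
  {ρ : Perm α →* Module.End ℝ V}

lemma swap_isSymmetric (hρ : ∀ g v w, ⟪ρ g v, w⟫_ℝ = ⟪v, ρ g⁻¹ w⟫_ℝ) (i j : α) :
    (ρ (swap i j)).IsSymmetric := fun v w => by
  rw [hρ, swap_inv]

lemma starSum_isSymmetric (hρ : ∀ g v w, ⟪ρ g v, w⟫_ℝ = ⟪v, ρ g⁻¹ w⟫_ℝ) (S : Finset α) (x : α) :
    (starSum ρ S x).IsSymmetric := fun v w => by
  simp only [starSum, LinearMap.sum_apply, sum_inner, inner_sum]
  exact Finset.sum_congr rfl fun i _ => swap_isSymmetric hρ i x v w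

omit [DecidableEq α] in
lemma inner_map_self_le (hρ : ∀ g v w, ⟪ρ g v, w⟫_ℝ = ⟪v, ρ g⁻¹ w⟫_ℝ) (g : Perm α) (v : V) :
    ⟪ρ g v, v⟫_ℝ ≤ ⟪v, v⟫_ℝ ∧ (⟪ρ g v, v⟫_ℝ = ⟪v, v⟫_ℝ → ρ g v = v) := by
  have h1 : ⟪ρ g v, ρ g v⟫_ℝ = ⟪v, v⟫_ℝ := by
    rw [hρ, ← Module.End.mul_apply, ← map_mul, inv_mul_cancel, map_one, Module.End.one_apply]
  have h2 : ⟪ρ g v - v, ρ g v - v⟫_ℝ = 2 * ⟪v, v⟫_ℝ - 2 * ⟪ρ g v, v⟫_ℝ := by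
    rw [inner_sub_left, inner_sub_right, inner_sub_right, h1, real_inner_comm (ρ g v) v]; ring
  have h3 : 0 ≤ ⟪ρ g v - v, ρ g v - v⟫_ℝ := real_inner_self_nonneg
  refine ⟨by linarith, fun h => ?_⟩
  rw [h, sub_self] at h2
  exact sub_eq_zero.1 (inner_self_eq_zero.1 h2)

lemma inner_starSum_self_le (hρ : ∀ g v w, ⟪ρ g v, w⟫_ℝ = ⟪v, ρ g⁻¹ w⟫_ℝ) (S : Finset α) (x : α)
    (v : V) : ⟪starSum ρ S x v, v⟫_ℝ ≤ S.card * ⟪v, v⟫_ℝ := by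
  rw [starSum, LinearMap.sum_apply, sum_inner, ← nsmul_eq_mul]
  exact Finset.sum_le_card_nsmul _ _ _ fun i _ => (inner_map_self_le hρ _ v).1

lemma starSum_eigenvalue_le (hρ : ∀ g v w, ⟪ρ g v, w⟫_ℝ = ⟪v, ρ g⁻¹ w⟫_ℝ) {S : Finset α} {x : α}
    {v : V} (hv : v ≠ 0) {c : ℝ} (hc : starSum ρ S x v = c • v) : c ≤ S.card := by
  have h := inner_starSum_self_le hρ S x v
  rw [hc, real_inner_smul_left] at h
  exact le_of_mul_le_mul_right h (real_inner_self_pos.2 hv)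

lemma swapFixed_of_starSum_eq (hρ : ∀ g v w, ⟪ρ g v, w⟫_ℝ = ⟪v, ρ g⁻¹ w⟫_ℝ) {S : Finset α} {x : α}
    {v : V} (hc : starSum ρ S x v = (S.card : ℝ) • v) : SwapFixed ρ (insert x S) v := by
  refine SwapFixed.insert_of_star ρ fun i hi => (inner_map_self_le hρ _ v).2 ?_
  have h1 : ∑ i ∈ S, ⟪ρ (swap i x) v, v⟫_ℝ = ∑ _i ∈ S, ⟪v, v⟫_ℝ := by
    rw [← sum_inner, ← LinearMap.sum_apply, ← starSum, hc, real_inner_smul_left, Finset.sum_const,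
      nsmul_eq_mul]
  exact (Finset.sum_eq_sum_iff_of_le fun i _ => (inner_map_self_le hρ (swap i x) v).1).1 h1 i hi

/-- Eigenvalues of sums of star transpositions are integers. -/
lemma exists_int_of_starSum_eq [FiniteDimensional ℝ V]
    (hρ : ∀ g v w, ⟪ρ g v, w⟫_ℝ = ⟪v, ρ g⁻¹ w⟫_ℝ) (S : Finset α) :
    ∀ (x : α) (v : V) (c : ℝ), x ∉ S → v ≠ 0 → starSum ρ S x v = c • v → ∃ z : ℤ, c = z := by
  induction S using Finset.induction_on with
  | empty =>
    intro x v c _ hv h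
    refine ⟨0, ?_⟩
    rw [starSum, Finset.sum_empty, LinearMap.zero_apply, eq_comm, smul_eq_zero] at h
    simpa using h.resolve_right hv
  | insert y S hy ih =>
    intro x v b hx hv hb
    obtain ⟨w, χ, hw, hbw, hχ⟩ := exists_joint_eigenvector_of_commute (ι := Unit)
      (T := fun _ => starSum ρ S y) (fun _ => starSum_isSymmetric hρ S y)
      (starSum_isSymmetric hρ (insert y S) x) (fun i j h => absurd rfl h)
      (fun _ => starSum_commute_starSum ρ subset_rfl hx) hv hb
    set a := χ ()
    have ha : starSum ρ S y w = a • w := hχ ()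
    obtain ⟨z, hz⟩ := ih y w a hy hw ha
    set s := ρ (swap y x)
    have hss : ∀ u, s (s u) = u := fun u => by
      rw [← Module.End.mul_apply, ← map_mul, swap_mul_self, map_one, Module.End.one_apply]
    have hrel : starSum ρ S y (s w) = b • s w - w := by
      rw [starSum_insert_eq ρ hx hy] at hbw
      simp only [LinearMap.add_apply, Module.End.mul_apply] at hbw
      have := congrArg s hbw
      rw [map_add, hss, hss, map_smul] at this
      rw [← this]; abel
    by_cases hab : b = a
    · exact ⟨z, by rw [hab, hz]⟩
    -- `s w - (b - a)⁻¹ w` is an eigenvector for `b` unless it vanishes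
    by_cases h0 : s w = (b - a)⁻¹ • w
    · have hba : b - a ≠ 0 := sub_ne_zero.2 hab
      have h1 : ((b - a)⁻¹ * (b - a)⁻¹) • w = (1 : ℝ) • w := by
        rw [mul_smul, ← h0, ← map_smul, ← h0, hss, one_smul]
      have h2 : (b - a)⁻¹ * (b - a)⁻¹ = 1 := smul_left_injective ℝ hw h1
      have h3 : (b - a - 1) * (b - a + 1) = 0 := by
        field_simp at h2
        linear_combination -h2
      rcases mul_eq_zero.1 h3 with h | h
      · exact ⟨z + 1, by push_cast; linarith⟩
      · exact ⟨z - 1, by push_cast; linarith⟩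
    · refine ih y (s w - (b - a)⁻¹ • w) b hy (sub_ne_zero.2 h0) ?_
      have hba : b - a ≠ 0 := sub_ne_zero.2 hab
      rw [map_sub, map_smul, hrel, ha, smul_sub, sub_sub, smul_smul, smul_smul]
      congr 1
      nth_rewrite 1 [← one_smul ℝ w]
      rw [← add_smul]
      congr 1
      field_simp
      ring

/-- A vector orthogonal to all invariants sees a spectral gap of one in the full star. -/
lemma inner_starSum_self_le_of_orthogonal [Fintype α] [FiniteDimensional ℝ V]
    (hρ : ∀ g v w, ⟪ρ g v, w⟫_ℝ = ⟪v, ρ g⁻¹ w⟫_ℝ) {S : Finset α} {x : α} (hx : x ∉ S)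
    (hS : insert x S = Finset.univ) {v : V}
    (hv : ∀ w, SwapFixed ρ Finset.univ w → ⟪v, w⟫_ℝ = 0) :
    ⟪starSum ρ S x v, v⟫_ℝ ≤ ((S.card : ℝ) - 1) * ⟪v, v⟫_ℝ := by
  refine inner_le_of_eigenvalues (starSum_isSymmetric hρ S x) fun w μ hw hμ => ?_
  by_cases h : μ = S.card
  · right
    exact hv w (hS ▸ swapFixed_of_starSum_eq hρ (h ▸ hμ))
  · left
    obtain ⟨z, rfl⟩ := exists_int_of_starSum_eq hρ S x w μ hx hw hμ
    have h1 := lt_of_le_of_ne (starSum_eigenvalue_le hρ hw hμ) h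
    have h2 : z < (S.card : ℤ) := by exact_mod_cast h1
    have h3 : z ≤ (S.card : ℤ) - 1 := by omega
    exact_mod_cast h3

lemma SwapFixed.eigenvalue_eq {S : Finset α} {x : α} {v : V} (h : SwapFixed ρ S v)
    (hx : x ∉ S) (hv : v ≠ 0) {c : ℝ} (hc : starSum ρ S x v = c • v) :
    c = S.card ∨ c = -1 := by
  have h1 := h.starSum_starSum ρ hx
  rw [hc, map_smul, hc, smul_smul, smul_smul, ← add_smul] at h1
  have h2 : c * c = S.card + ((S.card : ℝ) - 1) * c := smul_left_injective ℝ hv h1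
  have h3 : (c - S.card) * (c + 1) = 0 := by linear_combination h2
  rcases mul_eq_zero.1 h3 with h | h
  · left; linarith
  · right; linarith

lemma SwapFixed.neg_le_inner_starSum {S : Finset α} {x : α} {v : V} (h : SwapFixed ρ S v)
    (hρ : ∀ g v w, ⟪ρ g v, w⟫_ℝ = ⟪v, ρ g⁻¹ w⟫_ℝ) (hx : x ∉ S) :
    -⟪v, v⟫_ℝ ≤ ⟪starSum ρ S x v, v⟫_ℝ := by
  have h1 := h.starSum_starSum ρ hx
  have hs := starSum_isSymmetric hρ S x
  set J := starSum ρ S x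
  have h2 : ⟪J v, J v⟫_ℝ = S.card * ⟪v, v⟫_ℝ + ((S.card : ℝ) - 1) * ⟪J v, v⟫_ℝ := by
    rw [← hs (J v) v, h1, inner_add_left, real_inner_smul_left, real_inner_smul_left]
  have h3 : 0 ≤ ⟪J v + v, J v + v⟫_ℝ := real_inner_self_nonneg
  rw [inner_add_left, inner_add_right, inner_add_right, h2, real_inner_comm (J v) v] at h3
  have h4 : 0 ≤ ((S.card : ℝ) + 1) * (⟪J v, v⟫_ℝ + ⟪v, v⟫_ℝ) := by linarith
  have h5 : (0 : ℝ) < (S.card : ℝ) + 1 := by positivity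
  have := nonneg_of_mul_nonneg_right h4 h5
  linarith

end Orthogonal

section SignTwist

open scoped InnerProductSpace

variable {α : Type*} [Fintype α] [DecidableEq α]

/-- The tensor product of the representation `ρ` with the sign representation. -/
noncomputable def signTwist {V : Type*} [AddCommGroup V] [Module ℝ V]
    (ρ : Perm α →* Module.End ℝ V) : Perm α →* Module.End ℝ V where
  toFun g := ((Perm.sign g : ℤ) : ℝ) • ρ g
  map_one' := by simp
  map_mul' g h := by
    ext v
    simp [smul_smul, mul_comm]

lemma starSum_signTwist {V : Type*} [AddCommGroup V] [Module ℝ V] (ρ : Perm α →* Module.End ℝ V)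
    {S : Finset α} {x : α} (hx : x ∉ S) : starSum (signTwist ρ) S x = -starSum ρ S x := by
  unfold starSum
  rw [← Finset.sum_neg_distrib]
  refine Finset.sum_congr rfl fun i hi => ?_
  have : i ≠ x := fun h => hx (h ▸ hi)
  simp [signTwist, Perm.sign_swap this]

variable {V : Type*} [NormedAddCommGroup V] [InnerProductSpace ℝ V]
  {ρ : Perm α →* Module.End ℝ V}

lemma signTwist_orthogonal (hρ : ∀ g v w, ⟪ρ g v, w⟫_ℝ = ⟪v, ρ g⁻¹ w⟫_ℝ) (g : Perm α) (v w : V) :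
    ⟪signTwist ρ g v, w⟫_ℝ = ⟪v, signTwist ρ g⁻¹ w⟫_ℝ := by
  simp [signTwist, real_inner_smul_left, real_inner_smul_right, hρ]

lemma neg_le_starSum_eigenvalue (hρ : ∀ g v w, ⟪ρ g v, w⟫_ℝ = ⟪v, ρ g⁻¹ w⟫_ℝ) {S : Finset α}
    {x : α} (hx : x ∉ S) {v : V} (hv : v ≠ 0) {c : ℝ} (hc : starSum ρ S x v = c • v) :
    -(S.card : ℝ) ≤ c := by
  have h := starSum_eigenvalue_le (signTwist_orthogonal hρ) (S := S) (x := x) hv (c := -c)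
    (by rw [starSum_signTwist ρ hx, LinearMap.neg_apply, hc, neg_smul])
  linarith

end SignTwist

section Bipartite

open scoped InnerProductSpace

variable {α : Type*} [Fintype α] [DecidableEq α]

/-- The image under `ρ` of the sum of all transpositions `(i x)` with `i ∈ S` and `x ∉ S`. -/
noncomputable def bipartiteSum {V : Type*} [AddCommGroup V] [Module ℝ V]
    (ρ : Perm α →* Module.End ℝ V) (S : Finset α) : Module.End ℝ V :=
  ∑ x ∈ Sᶜ, starSum ρ S x

lemma bipartiteSum_signTwist {V : Type*} [AddCommGroup V] [Module ℝ V]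
    (ρ : Perm α →* Module.End ℝ V) (S : Finset α) :
    bipartiteSum (signTwist ρ) S = -bipartiteSum ρ S := by
  unfold bipartiteSum
  rw [← Finset.sum_neg_distrib]
  exact Finset.sum_congr rfl fun x hx => starSum_signTwist ρ (Finset.mem_compl.1 hx)

lemma starSum_commute_bipartiteSum {V : Type*} [AddCommGroup V] [Module ℝ V]
    (ρ : Perm α →* Module.End ℝ V) {S S' : Finset α} {y : α} (hS : insert y S ⊆ S') :
    Commute (starSum ρ S y) (bipartiteSum ρ S') :=
  Commute.sum_right _ _ _ fun _ hx => starSum_commute_starSum ρ hS (Finset.mem_compl.1 hx)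

lemma SwapFixed.bipartiteSum_apply {V : Type*} [AddCommGroup V] [Module ℝ V]
    {ρ : Perm α →* Module.End ℝ V} {S : Finset α} {v : V} (h : SwapFixed ρ Finset.univ v) :
    bipartiteSum ρ S v = ((S.card : ℝ) * (Sᶜ.card : ℝ)) • v := by
  rw [bipartiteSum, LinearMap.sum_apply, Finset.sum_congr rfl (fun x _ =>
    h.starSum_apply ρ (Finset.subset_univ S) (Finset.mem_univ x)), Finset.sum_const,
    ← Nat.cast_smul_eq_nsmul ℝ, smul_smul, mul_comm]

variable {V : Type*} [NormedAddCommGroup V] [InnerProductSpace ℝ V]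
  {ρ : Perm α →* Module.End ℝ V}

lemma bipartiteSum_isSymmetric (hρ : ∀ g v w, ⟪ρ g v, w⟫_ℝ = ⟪v, ρ g⁻¹ w⟫_ℝ) (S : Finset α) :
    (bipartiteSum ρ S).IsSymmetric := fun v w => by
  simp only [bipartiteSum, LinearMap.sum_apply, sum_inner, inner_sum]
  exact Finset.sum_congr rfl fun x _ => starSum_isSymmetric hρ S x v w

lemma bipartiteSum_eigenvalue_le (hρ : ∀ g v w, ⟪ρ g v, w⟫_ℝ = ⟪v, ρ g⁻¹ w⟫_ℝ) {S : Finset α}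
    {v : V} (hv : v ≠ 0) {t : ℝ} (ht : bipartiteSum ρ S v = t • v) :
    t ≤ S.card * Sᶜ.card := by
  have h1 : ⟪bipartiteSum ρ S v, v⟫_ℝ ≤ Sᶜ.card • (S.card * ⟪v, v⟫_ℝ) := by
    rw [bipartiteSum, LinearMap.sum_apply, sum_inner]
    exact Finset.sum_le_card_nsmul _ _ _ fun x _ => inner_starSum_self_le hρ S x v
  rw [ht, real_inner_smul_left, nsmul_eq_mul, ← mul_assoc, mul_comm (Sᶜ.card : ℝ)] at h1
  exact le_of_mul_le_mul_right h1 (real_inner_self_pos.2 hv)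

lemma abs_bipartiteSum_eigenvalue_le (hρ : ∀ g v w, ⟪ρ g v, w⟫_ℝ = ⟪v, ρ g⁻¹ w⟫_ℝ) {S : Finset α}
    {v : V} (hv : v ≠ 0) {t : ℝ} (ht : bipartiteSum ρ S v = t • v) :
    |t| ≤ S.card * Sᶜ.card := by
  refine abs_le'.2 ⟨bipartiteSum_eigenvalue_le hρ hv ht, ?_⟩
  refine bipartiteSum_eigenvalue_le (signTwist_orthogonal hρ) hv ?_
  rw [bipartiteSum_signTwist, LinearMap.neg_apply, ht, neg_smul]

lemma SwapFixed.neg_le_bipartiteSum_eigenvalue {S : Finset α} {v : V} (h : SwapFixed ρ S v)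
    (hρ : ∀ g v w, ⟪ρ g v, w⟫_ℝ = ⟪v, ρ g⁻¹ w⟫_ℝ) (hv : v ≠ 0) {t : ℝ}
    (ht : bipartiteSum ρ S v = t • v) : -(Sᶜ.card : ℝ) ≤ t := by
  have h1 : Sᶜ.card • (-⟪v, v⟫_ℝ) ≤ ⟪bipartiteSum ρ S v, v⟫_ℝ := by
    rw [bipartiteSum, LinearMap.sum_apply, sum_inner]
    exact Finset.card_nsmul_le_sum _ _ _ fun x hx =>
      h.neg_le_inner_starSum hρ (Finset.mem_compl.1 hx)
  rw [ht, real_inner_smul_left, nsmul_eq_mul] at h1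
  refine le_of_mul_le_mul_right ?_ (real_inner_self_pos.2 hv)
  linarith

/-- By symmetry in `S`, the quadratic form of `bipartiteSum ρ S` reduces to that of the full star
centred at a point of `S`, which has a spectral gap. -/
lemma SwapFixed.inner_bipartiteSum_le [FiniteDimensional ℝ V] {S : Finset α} {v : V}
    (h : SwapFixed ρ S v) (hρ : ∀ g v w, ⟪ρ g v, w⟫_ℝ = ⟪v, ρ g⁻¹ w⟫_ℝ) (hS : S.Nonempty)
    (hv : ∀ w, SwapFixed ρ Finset.univ w → ⟪v, w⟫_ℝ = 0) :
    ⟪bipartiteSum ρ S v, v⟫_ℝ ≤ S.card * ((Sᶜ.card : ℝ) - 1) * ⟪v, v⟫_ℝ := by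
  obtain ⟨a, ha⟩ := hS
  have hsymm : ∀ x ∈ Sᶜ, ∀ i ∈ S, ⟪ρ (swap i x) v, v⟫_ℝ = ⟪ρ (swap x a) v, v⟫_ℝ := by
    intro x hx i hi
    rw [Finset.mem_compl] at hx
    rcases eq_or_ne i a with rfl | hia
    · rw [swap_comm]
    have hxi : x ≠ i := fun h => hx (h ▸ hi)
    have hxa : x ≠ a := fun h => hx (h ▸ ha)
    have h1 : swap i a * swap x a = swap i x * swap i a := by
      rw [mul_swap_eq_swap_mul, swap_apply_of_ne_of_ne hxi hxa, swap_apply_right, swap_comm x i]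
    have h2 : ρ (swap i x) v = ρ (swap i a) (ρ (swap x a) v) := by
      rw [← Module.End.mul_apply, ← map_mul, h1, map_mul, Module.End.mul_apply, h i hi a ha]
    rw [h2, hρ, swap_inv, h i hi a ha]
  have hT : ⟪bipartiteSum ρ S v, v⟫_ℝ = S.card * ∑ x ∈ Sᶜ, ⟪ρ (swap x a) v, v⟫_ℝ := by
    rw [bipartiteSum, LinearMap.sum_apply, sum_inner, Finset.mul_sum]
    refine Finset.sum_congr rfl fun x hx => ?_
    rw [starSum, LinearMap.sum_apply, sum_inner, Finset.sum_congr rfl (hsymm x hx),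
      Finset.sum_const, nsmul_eq_mul]
  have hL : ⟪starSum ρ (Finset.univ.erase a) a v, v⟫_ℝ =
      ∑ x ∈ Sᶜ, ⟪ρ (swap x a) v, v⟫_ℝ + ((S.card : ℝ) - 1) * ⟪v, v⟫_ℝ := by
    have hU : (Finset.univ.erase a : Finset α) = Sᶜ ∪ S.erase a := by
      ext z
      simp only [Finset.mem_erase, Finset.mem_univ, and_true, Finset.mem_union, Finset.mem_compl]
      constructor
      · tauto
      · rintro (hz | hz)
        · rintro rfl; exact hz ha
        · exact hz.1
    have hdisj : Disjoint Sᶜ (S.erase a) :=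
      Finset.disjoint_left.2 fun z hz hz' => Finset.mem_compl.1 hz (Finset.mem_of_mem_erase hz')
    rw [starSum, LinearMap.sum_apply, sum_inner, hU, Finset.sum_union hdisj]
    congr 1
    rw [Finset.sum_congr rfl (fun i hi => by rw [h i (Finset.mem_of_mem_erase hi) a ha]),
      Finset.sum_const, nsmul_eq_mul, Finset.card_erase_of_mem ha,
      Nat.cast_sub (Finset.card_pos.2 ⟨a, ha⟩), Nat.cast_one]
  have hgap := inner_starSum_self_le_of_orthogonal hρ (Finset.notMem_erase a Finset.univ)
    (Finset.insert_erase (Finset.mem_univ a)) hv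
  have hcard : ((Finset.univ.erase a : Finset α).card : ℝ) = S.card + Sᶜ.card - 1 := by
    have h1 := Finset.card_erase_add_one (Finset.mem_univ a)
    rw [Finset.card_univ, ← Finset.card_add_card_compl S] at h1
    have h2 : ((Finset.univ.erase a : Finset α).card : ℝ) + 1 = S.card + Sᶜ.card := by
      exact_mod_cast h1
    linarith
  rw [hL, hcard] at hgap
  rw [hT, mul_assoc]
  refine mul_le_mul_of_nonneg_left ?_ (Nat.cast_nonneg _)
  linarith

lemma SwapFixed.bipartiteSum_eigenvalue [FiniteDimensional ℝ V] {S : Finset α} {v : V}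
    (h : SwapFixed ρ S v) (hρ : ∀ g v w, ⟪ρ g v, w⟫_ℝ = ⟪v, ρ g⁻¹ w⟫_ℝ) (hS : S.Nonempty)
    (hv : v ≠ 0) {t : ℝ} (ht : bipartiteSum ρ S v = t • v) :
    t = S.card * Sᶜ.card ∨ t ≤ S.card * ((Sᶜ.card : ℝ) - 1) := by
  by_cases hinv : ∀ w, SwapFixed ρ Finset.univ w → ⟪v, w⟫_ℝ = 0
  · right
    have h1 := h.inner_bipartiteSum_le hρ hS hinv
    rw [ht, real_inner_smul_left] at h1
    exact le_of_mul_le_mul_right h1 (real_inner_self_pos.2 hv)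
  · left
    push Not at hinv
    obtain ⟨w, hw, hvw⟩ := hinv
    refine mul_right_cancel₀ hvw ?_
    rw [← real_inner_smul_left, ← ht, bipartiteSum_isSymmetric hρ S v w, hw.bipartiteSum_apply,
      real_inner_smul_right]

end Bipartite

section Chain

open scoped InnerProductSpace

variable {α : Type*} [DecidableEq α]

/-- The set of the first `k` terms of the sequence `p`. -/
def initialSet (p : ℕ → α) (k : ℕ) : Finset α := (Finset.range k).image p

lemma initialSet_succ (p : ℕ → α) (k : ℕ) :
    initialSet p (k + 1) = insert (p k) (initialSet p k) := by
  rw [initialSet, Finset.range_add_one, Finset.image_insert, initialSet]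

lemma initialSet_mono (p : ℕ → α) {j k : ℕ} (h : j ≤ k) : initialSet p j ⊆ initialSet p k :=
  Finset.image_subset_image (Finset.range_mono h)

lemma card_initialSet {p : ℕ → α} {r : ℕ} (hp : ∀ k < r, p k ∉ initialSet p k) :
    ∀ k ≤ r, (initialSet p k).card = k := by
  intro k hk
  induction k with
  | zero => simp [initialSet]
  | succ k ih => rw [initialSet_succ, Finset.card_insert_of_notMem (hp k hk), ih (by omega)]

variable [Fintype α]

lemma cycleSum_initialSet_apply {V : Type*} [AddCommGroup V] [Module ℝ V]
    (ρ : Perm α →* Module.End ℝ V) {p : ℕ → α} {r : ℕ} (hp : ∀ k < r, p k ∉ initialSet p k)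
    {w : V} {c : ℕ → ℝ}
    (hc : ∀ k, 1 ≤ k → k < r → starSum ρ (initialSet p k) (p k) w = c k • w) {j : ℕ} (hj : 2 ≤ j)
    (hjr : j ≤ r) :
    cycleSum ρ (initialSet p j) w = (∏ k ∈ Finset.Ico 1 j, c k) • w := by
  induction j, hj using Nat.le_induction with
  | base =>
    have h0 : initialSet p 1 = {p 0} := by simp [initialSet]
    have h1 := hc 1 le_rfl (by omega)
    rw [h0, starSum, Finset.sum_singleton] at h1
    have hne : p 1 ≠ p 0 := by
      have := hp 1 (by omega)
      rwa [h0, Finset.mem_singleton] at this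
    rw [initialSet_succ, h0, cycleSum_pair ρ hne, swap_comm, h1]
    simp
  | succ j hj ih =>
    have hcard := card_initialSet hp j (by omega)
    rw [initialSet_succ, cycleSum_insert ρ (hp j (by omega)) (by omega), Module.End.mul_apply,
      ih (by omega), map_smul, hc j (by omega) (by omega), Finset.prod_Ico_succ_top (by omega),
      smul_smul]

variable {V : Type*} [NormedAddCommGroup V] [InnerProductSpace ℝ V]
  {ρ : Perm α →* Module.End ℝ V}

lemma abs_prod_eigenvalues_le (hρ : ∀ g v w, ⟪ρ g v, w⟫_ℝ = ⟪v, ρ g⁻¹ w⟫_ℝ) {p : ℕ → α} {r : ℕ}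
    (hp : ∀ k < r, p k ∉ initialSet p k) {w : V} (hw : w ≠ 0) {c : ℕ → ℝ}
    (hc : ∀ k, 1 ≤ k → k < r → starSum ρ (initialSet p k) (p k) w = c k • w) {j : ℕ}
    (hjr : j + 1 ≤ r) : |∏ k ∈ Finset.Ico 1 (j + 1), c k| ≤ j.factorial := by
  rw [Finset.abs_prod, ← Finset.prod_Ico_id_eq_factorial, Nat.cast_prod]
  refine Finset.prod_le_prod (fun _ _ => abs_nonneg _) fun k hk => ?_
  rw [Finset.mem_Ico] at hk
  have hck := hc k hk.1 (by omega)
  have hcard := card_initialSet hp k (by omega)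
  have h1 := starSum_eigenvalue_le hρ hw hck
  have h2 := neg_le_starSum_eigenvalue hρ (hp k (by omega)) hw hck
  rw [hcard] at h1 h2
  exact abs_le.2 ⟨h2, h1⟩

lemma swapFixed_or_abs_prod_le [FiniteDimensional ℝ V]
    (hρ : ∀ g v w, ⟪ρ g v, w⟫_ℝ = ⟪v, ρ g⁻¹ w⟫_ℝ) {p : ℕ → α} {r : ℕ}
    (hp : ∀ k < r, p k ∉ initialSet p k) {w : V} (hw : w ≠ 0) {c : ℕ → ℝ}
    (hc : ∀ k, 1 ≤ k → k < r → starSum ρ (initialSet p k) (p k) w = c k • w) {j : ℕ} (hj : 2 ≤ j)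
    (hjr : j ≤ r) :
    SwapFixed ρ (initialSet p j) w ∨ SwapFixed (signTwist ρ) (initialSet p j) w ∨
      (3 ≤ j ∧ |∏ k ∈ Finset.Ico 1 j, c k| ≤ (j - 2).factorial) := by
  have main : ∀ k, 1 ≤ k → k < r → SwapFixed ρ (initialSet p (k + 1)) w ∨
      SwapFixed (signTwist ρ) (initialSet p (k + 1)) w ∨ |c k| ≤ k - 1 := by
    intro k hk hkr
    have hck := hc k hk hkr
    have hcard := card_initialSet hp k hkr.le
    have h1 := starSum_eigenvalue_le hρ hw hck
    have h2 := neg_le_starSum_eigenvalue hρ (hp k hkr) hw hck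
    obtain ⟨z, hz⟩ := exists_int_of_starSum_eq hρ _ _ w (c k) (hp k hkr) hw hck
    rw [hcard] at h1 h2
    rw [initialSet_succ]
    by_cases h3 : c k = k
    · left
      refine swapFixed_of_starSum_eq hρ ?_
      rw [hck, hcard, h3]
    by_cases h4 : c k = -k
    · right; left
      refine swapFixed_of_starSum_eq (signTwist_orthogonal hρ) ?_
      rw [starSum_signTwist ρ (hp k hkr), LinearMap.neg_apply, hck, hcard, h4, neg_smul, neg_neg]
    · right; right
      rw [hz] at h1 h2 h3 h4 ⊢
      have h1' : z ≤ (k : ℤ) := by exact_mod_cast h1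
      have h2' : -(k : ℤ) ≤ z := by exact_mod_cast h2
      have h3' : z ≠ (k : ℤ) := by exact_mod_cast h3
      have h4' : z ≠ -(k : ℤ) := by exact_mod_cast h4
      have : |z| ≤ (k : ℤ) - 1 := abs_le.2 ⟨by omega, by omega⟩
      exact_mod_cast this
  induction j, hj using Nat.le_induction with
  | base =>
    rcases main 1 le_rfl (by omega) with h | h | h
    · exact Or.inl h
    · exact Or.inr (Or.inl h)
    · exfalso
      have h0 : c 1 = 0 := by simpa using h
      have h1 := hc 1 le_rfl (by omega)
      rw [h0, zero_smul, initialSet, Finset.range_one, Finset.image_singleton, starSum,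
        Finset.sum_singleton] at h1
      have h2 : ρ (swap (p 0) (p 1)) (ρ (swap (p 0) (p 1)) w) = w := by
        rw [← Module.End.mul_apply, ← map_mul, swap_mul_self, map_one, Module.End.one_apply]
      rw [h1, map_zero] at h2
      exact hw h2.symm
  | succ j hj ih =>
    rcases main j (by omega) (by omega) with h | h | h
    · exact Or.inl h
    · exact Or.inr (Or.inl h)
    refine Or.inr (Or.inr ⟨by omega, ?_⟩)
    rw [Finset.prod_Ico_succ_top (by omega), abs_mul]
    have hcj := hc j (by omega) (by omega)
    have hcard := card_initialSet hp j (by omega)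
    have hpj := hp j (by omega)
    obtain ⟨i, rfl⟩ : ∃ i, j = i + 2 := ⟨j - 2, by omega⟩
    have hprod := abs_prod_eigenvalues_le hρ hp hw hc (j := i + 1) (by omega)
    have hone : |c (i + 2)| ≤ 1 → |∏ k ∈ Finset.Ico 1 (i + 2), c k| * |c (i + 2)| ≤
        ((i + 2 + 1 - 2).factorial : ℝ) := fun h1 =>
      (mul_le_of_le_one_right (abs_nonneg _) h1).trans hprod
    rcases ih (by omega) with h1 | h1 | ⟨h3, h1⟩
    · apply hone
      rcases h1.eigenvalue_eq hpj hw hcj with h2 | h2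
      · rw [h2, hcard, abs_of_nonneg (by positivity)] at h
        linarith
      · rw [h2]; simp
    · apply hone
      rcases h1.eigenvalue_eq hpj hw (c := -c (i + 2))
        (by rw [starSum_signTwist ρ hpj, LinearMap.neg_apply, hcj, neg_smul]) with h2 | h2
      · rw [← abs_neg, h2, hcard, abs_of_nonneg (by positivity)] at h
        linarith
      · rw [← abs_neg, h2]; simp
    · have hf : ((i + 2 + 1 - 2).factorial : ℝ) = (i.factorial : ℝ) * (((i + 2 : ℕ) : ℝ) - 1) := by
        rw [show i + 2 + 1 - 2 = i + 1 by omega, Nat.factorial_succ]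
        push_cast; ring
      rw [hf]
      exact mul_le_mul h1 h (abs_nonneg _) (by positivity)

end Chain

section CycleOperator

open scoped InnerProductSpace

variable {α : Type*} [Fintype α] [DecidableEq α]

lemma sum_cycleSum_insert {V : Type*} [AddCommGroup V] [Module ℝ V]
    (ρ : Perm α →* Module.End ℝ V) {S : Finset α} (hS : 2 ≤ S.card) :
    ∑ x ∈ Sᶜ, cycleSum ρ (insert x S) = bipartiteSum ρ S * cycleSum ρ S := by
  rw [bipartiteSum, Finset.sum_mul]
  exact Finset.sum_congr rfl fun x hx => cycleSum_insert ρ (Finset.mem_compl.1 hx) hS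

lemma SwapFixed.cycleSum_initialSet_apply {V : Type*} [AddCommGroup V] [Module ℝ V]
    {ρ : Perm α →* Module.End ℝ V} {p : ℕ → α} {r : ℕ} (hp : ∀ k < r, p k ∉ initialSet p k)
    (hr : 2 ≤ r) {w : V} (hw : SwapFixed ρ (initialSet p r) w) :
    cycleSum ρ (initialSet p r) w = ((r - 1).factorial : ℝ) • w := by
  rw [_root_.cycleSum_initialSet_apply ρ hp (c := fun k => (k : ℝ)) _ hr le_rfl]
  · obtain ⟨s, rfl⟩ : ∃ s, r = s + 1 := ⟨r - 1, by omega⟩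
    rw [← Nat.cast_prod, Finset.prod_Ico_id_eq_factorial, Nat.add_sub_cancel]
  · intro k _ hk
    have h1 : initialSet p (k + 1) ⊆ initialSet p r := initialSet_mono p hk
    rw [initialSet_succ] at h1
    rw [hw.starSum_apply ρ ((Finset.subset_insert _ _).trans h1)
      (h1 (Finset.mem_insert_self _ _)), card_initialSet hp k hk.le]

variable {V : Type*} [NormedAddCommGroup V] [InnerProductSpace ℝ V]
  {ρ : Perm α →* Module.End ℝ V}

lemma cycleSum_isSymmetric (hρ : ∀ g v w, ⟪ρ g v, w⟫_ℝ = ⟪v, ρ g⁻¹ w⟫_ℝ) (S : Finset α) :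
    (cycleSum ρ S).IsSymmetric := fun v w => by
  simp only [cycleSum, LinearMap.sum_apply, sum_inner, inner_sum]
  refine Finset.sum_bij' (fun g _ => g⁻¹) (fun g _ => g⁻¹) ?_ ?_ ?_ ?_ ?_
  · intro g hg
    simp only [Finset.mem_filter, Finset.mem_univ, true_and] at hg ⊢
    exact ⟨hg.1.inv, by rw [Perm.support_inv, hg.2]⟩
  · intro g hg
    simp only [Finset.mem_filter, Finset.mem_univ, true_and] at hg ⊢
    exact ⟨hg.1.inv, by rw [Perm.support_inv, hg.2]⟩
  · simp
  · simp
  · intro g _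
    exact hρ g v w

lemma cycleOperator_eigenvalue [FiniteDimensional ℝ V]
    (hρ : ∀ g v w, ⟪ρ g v, w⟫_ℝ = ⟪v, ρ g⁻¹ w⟫_ℝ) {p : ℕ → α} {r : ℕ}
    (hp : ∀ k < r, p k ∉ initialSet p k) (hr : 2 ≤ r) {m : ℕ} (hm : (initialSet p r)ᶜ.card = m)
    (hm2 : 2 ≤ m) {v : V} (hv : v ≠ 0) {μ : ℝ}
    (hμ : (∑ x ∈ (initialSet p r)ᶜ, cycleSum ρ (insert x (initialSet p r))) v = μ • v) :
    μ = r.factorial * m ∨ μ ≤ r.factorial * ((m : ℝ) - 1) := by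
  set S := initialSet p r with hS
  have hcard : S.card = r := card_initialSet hp r le_rfl
  have hne : S.Nonempty := Finset.card_pos.1 (by omega)
  let T : Option (Fin r) → Module.End ℝ V := fun o =>
    o.elim (bipartiteSum ρ S) fun k => starSum ρ (initialSet p k) (p k)
  have hT : ∀ o, (T o).IsSymmetric := by
    rintro (_ | k)
    exacts [bipartiteSum_isSymmetric hρ S, starSum_isSymmetric hρ _ _]
  have hlt : ∀ j k : Fin r, j < k →
      Commute (starSum ρ (initialSet p j) (p j)) (starSum ρ (initialSet p k) (p k)) := by
    intro j k hjk
    refine starSum_commute_starSum ρ ?_ (hp k k.2)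
    rw [← initialSet_succ]
    exact initialSet_mono p hjk
  have hcomp : ∀ k : Fin r, Commute (starSum ρ (initialSet p k) (p k)) (bipartiteSum ρ S) := by
    intro k
    refine starSum_commute_bipartiteSum ρ ?_
    rw [← initialSet_succ]
    exact initialSet_mono p k.2
  have hC : Pairwise (Function.onFun Commute T) := by
    rintro (_ | j) (_ | k) hjk
    · exact absurd rfl hjk
    · exact (hcomp k).symm
    · exact hcomp j
    · have : j ≠ k := fun h => hjk (by rw [h])
      rcases lt_or_gt_of_ne this with h | h
      · exact hlt j k h
      · exact (hlt k j h).symm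
  obtain ⟨w, χ, hχ, hvw⟩ := exists_joint_eigenvector hT hC hv
  have hw : w ≠ 0 := by
    rintro rfl
    exact hvw (inner_zero_right v)
  set t := χ none
  have ht : bipartiteSum ρ S w = t • w := hχ none
  let c : ℕ → ℝ := fun k => if h : k < r then χ (some ⟨k, h⟩) else 0
  have hc : ∀ k, 1 ≤ k → k < r → starSum ρ (initialSet p k) (p k) w = c k • w := by
    intro k _ hk
    simp only [c, dif_pos hk]
    exact hχ (some ⟨k, hk⟩)
  have hD := cycleSum_initialSet_apply ρ hp hc hr le_rfl
  rw [← hS] at hD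
  have hμw : μ = t * ∏ k ∈ Finset.Ico 1 r, c k := by
    refine mul_right_cancel₀ hvw ?_
    rw [← real_inner_smul_left, ← hμ, LinearMap.sum_apply, sum_inner,
      Finset.sum_congr rfl (fun x _ => cycleSum_isSymmetric hρ (insert x S) v w), ← inner_sum,
      ← LinearMap.sum_apply, sum_cycleSum_insert ρ (by omega), Module.End.mul_apply, hD, map_smul,
      ht, smul_smul, real_inner_smul_right, mul_comm t]
  have hm' : (2 : ℝ) ≤ m := by exact_mod_cast hm2
  obtain ⟨s, rfl⟩ : ∃ s, r = s + 2 := ⟨r - 2, by omega⟩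
  have hF : (0 : ℝ) < s.factorial := by positivity
  have hf2 : ((s + 2).factorial : ℝ) = (s + 2) * (s + 1).factorial := by
    rw [Nat.factorial_succ]; push_cast; ring
  have hf1 : ((s + 1).factorial : ℝ) = (s + 1) * s.factorial := by
    rw [Nat.factorial_succ]; push_cast; ring
  have hF1 : (0 : ℝ) < (s + 1).factorial := by positivity
  have hs : (0 : ℝ) ≤ s := Nat.cast_nonneg s
  rcases swapFixed_or_abs_prod_le hρ hp hw hc hr le_rfl with h | h | ⟨h3, h⟩
  · have hprod : ∏ k ∈ Finset.Ico 1 (s + 2), c k = (s + 1).factorial :=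
      smul_left_injective ℝ hw (hD.symm.trans (h.cycleSum_initialSet_apply hp hr))
    rw [hprod] at hμw
    rw [hμw, hf2]
    rcases h.bipartiteSum_eigenvalue hρ hne hw ht with h1 | h1 <;> rw [hcard, hm] at h1 <;>
      push_cast at h1
    · left; rw [h1]; ring
    · right; nlinarith
  · have hρ' := signTwist_orthogonal hρ
    have ht' : bipartiteSum (signTwist ρ) S w = (-t) • w := by
      rw [bipartiteSum_signTwist, LinearMap.neg_apply, ht, neg_smul]
    have hprod' := h.cycleSum_initialSet_apply hp hr
    rw [cycleSum_initialSet_apply (signTwist ρ) hp (c := fun k => -c k) (fun k h1 h2 => by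
      rw [starSum_signTwist ρ (hp k h2), LinearMap.neg_apply, hc k h1 h2, neg_smul]) hr le_rfl,
      Finset.prod_neg, Nat.card_Ico] at hprod'
    have hprod : (-1) ^ (s + 1) * ∏ k ∈ Finset.Ico 1 (s + 2), c k = ((s + 1).factorial : ℝ) :=
      smul_left_injective ℝ hw hprod'
    rcases Nat.even_or_odd (s + 1) with he | ho
    · rw [he.neg_one_pow, one_mul] at hprod
      rw [hprod] at hμw
      right
      have h1 := h.neg_le_bipartiteSum_eigenvalue hρ' hw ht'
      rw [hm] at h1
      have hs1 : (1 : ℝ) ≤ s := by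
        have : 1 ≤ s := by
          by_contra hcon
          obtain rfl : s = 0 := by omega
          exact absurd he (by decide)
        exact_mod_cast this
      rw [hμw, hf2, mul_comm t, mul_comm ((s : ℝ) + 2), mul_assoc]
      refine mul_le_mul_of_nonneg_left ?_ hF1.le
      nlinarith
    · rw [ho.neg_one_pow, neg_one_mul] at hprod
      have hμ' : μ = (-t) * (s + 1).factorial := by rw [hμw, ← hprod]; ring
      rw [hμ', hf2]
      rcases h.bipartiteSum_eigenvalue hρ' hne hw ht' with h1 | h1 <;> rw [hcard, hm] at h1 <;>
        push_cast at h1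
      · left; rw [h1]; ring
      · right; nlinarith
  · right
    have h1 := abs_bipartiteSum_eigenvalue_le hρ hw ht
    rw [hcard, hm] at h1
    have hs1 : (1 : ℝ) ≤ s := by
      have : 1 ≤ s := by omega
      exact_mod_cast this
    rw [Nat.add_sub_cancel] at h
    calc μ ≤ |t * ∏ k ∈ Finset.Ico 1 (s + 2), c k| := hμw ▸ le_abs_self _
      _ = |t| * |∏ k ∈ Finset.Ico 1 (s + 2), c k| := abs_mul _ _
      _ ≤ ((s + 2 : ℕ) * m) * s.factorial :=
        mul_le_mul h1 h (abs_nonneg _) (by positivity)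
      _ ≤ (s + 2).factorial * ((m : ℝ) - 1) := by
        rw [hf2, hf1]
        push_cast
        have h2 : (m : ℝ) ≤ (s + 1) * (m - 1) := by nlinarith
        have h3 : (0 : ℝ) ≤ (s + 2) * s.factorial := by positivity
        nlinarith [mul_le_mul_of_nonneg_left h2 h3]

end CycleOperator

section RegularRepresentation

open scoped InnerProductSpace

variable {α : Type*} [Fintype α] [DecidableEq α]

/-- The left regular representation of `Perm α` on real functions. -/
noncomputable def leftRegular (α : Type*) [Fintype α] [DecidableEq α] :
    Perm α →* Module.End ℝ (EuclideanSpace ℝ (Perm α)) where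
  toFun g :=
    { toFun := fun f => WithLp.toLp 2 fun u => f (g⁻¹ * u)
      map_add' := fun _ _ => rfl
      map_smul' := fun _ _ => rfl }
  map_one' := by ext f u; simp
  map_mul' g h := by
    ext f u
    simp only [mul_inv_rev, mul_assoc]
    rfl

lemma leftRegular_apply (g : Perm α) (f : EuclideanSpace ℝ (Perm α)) (u : Perm α) :
    leftRegular α g f u = f (g⁻¹ * u) := rfl

lemma leftRegular_orthogonal (g : Perm α) (v w : EuclideanSpace ℝ (Perm α)) :
    ⟪leftRegular α g v, w⟫_ℝ = ⟪v, leftRegular α g⁻¹ w⟫_ℝ := by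
  simp only [PiLp.inner_apply, leftRegular_apply, inv_inv]
  refine Fintype.sum_equiv (Equiv.mulLeft g⁻¹) _ _ fun u => ?_
  simp

/-- The function `u ↦ φ (u y)` on `Perm α`. -/
noncomputable def evalFunction (φ : α → ℝ) (y : α) : EuclideanSpace ℝ (Perm α) :=
  WithLp.toLp 2 fun u => φ (u y)

omit [Fintype α] [DecidableEq α] in
lemma evalFunction_apply (φ : α → ℝ) (y : α) (u : Perm α) : evalFunction φ y u = φ (u y) := rfl

lemma swapFixed_evalFunction {S : Finset α} {φ : α → ℝ} (y : α) (hφ : ∀ i ∈ S, φ i = 0) :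
    SwapFixed (leftRegular α) S (evalFunction φ y) := by
  intro i hi j hj
  ext u
  rw [leftRegular_apply, evalFunction_apply, evalFunction_apply, swap_inv, Perm.mul_apply]
  rcases eq_or_ne (u y) i with h | h
  · rw [h, swap_apply_left, hφ i hi, hφ j hj]
  rcases eq_or_ne (u y) j with h' | h'
  · rw [h', swap_apply_right, hφ i hi, hφ j hj]
  rw [swap_apply_of_ne_of_ne h h']

lemma bipartiteSum_evalFunction {S : Finset α} {φ : α → ℝ} (y : α) (hφ : ∀ i ∈ S, φ i = 0)
    (hsum : ∑ x ∈ Sᶜ, φ x = 0) :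
    bipartiteSum (leftRegular α) S (evalFunction φ y) =
      (S.card * ((Sᶜ.card : ℝ) - 1)) • evalFunction φ y := by
  ext u
  have h1 : bipartiteSum (leftRegular α) S (evalFunction φ y) u =
      ∑ x ∈ Sᶜ, ∑ i ∈ S, φ (swap i x (u y)) := by
    simp only [bipartiteSum, starSum, LinearMap.sum_apply, WithLp.ofLp_sum, Finset.sum_apply]
    rfl
  rw [h1, PiLp.smul_apply, evalFunction_apply, smul_eq_mul]
  generalize u y = z
  have h2 : ∀ x ∈ Sᶜ, ∀ i ∈ S, φ (swap i x z) =
      φ z + (if z = i then φ x else 0) - (if z = x then φ x else 0) := by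
    intro x hx i hi
    rw [Finset.mem_compl] at hx
    have hix : i ≠ x := fun h => hx (h ▸ hi)
    rcases eq_or_ne z i with rfl | h
    · rw [swap_apply_left, if_pos rfl, if_neg hix, hφ _ hi]; ring
    rcases eq_or_ne z x with rfl | h'
    · rw [swap_apply_right, if_neg h, if_pos rfl, hφ i hi]; ring
    · rw [swap_apply_of_ne_of_ne h h', if_neg h, if_neg h']; ring
  rw [Finset.sum_congr rfl fun x hx => Finset.sum_congr rfl (h2 x hx)]
  simp only [Finset.sum_sub_distrib, Finset.sum_add_distrib, Finset.sum_const, Finset.sum_ite_eq,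
    nsmul_eq_mul, ← Finset.mul_sum, Finset.mem_compl]
  by_cases hz : z ∈ S
  · simp [hz, hφ z hz, hsum]
  · simp [hz]; ring

end RegularRepresentation

section Graph

lemma mem_graphEigs_cayleyGraph {G : Type*} [Group G] [Fintype G] {H : Set G}
    [DecidablePred (· ∈ H)] (h1 : (1 : G) ∉ H) (hinv : ∀ h ∈ H, h⁻¹ ∈ H) (μ : ℝ) :
    μ ∈ graphEigs (cayleyGraph H) ↔
      ∃ f : G → ℝ, f ≠ 0 ∧ ∀ u, ∑ h with h ∈ H, f (h⁻¹ * u) = μ * f u := by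
  classical
  have hadj : ∀ u v, (cayleyGraph H).Adj u v ↔ u * v⁻¹ ∈ H := by
    intro u v
    rw [cayleyGraph, SimpleGraph.fromRel_adj]
    constructor
    · rintro ⟨-, h | h⟩
      · exact h
      · simpa using hinv _ h
    · intro h
      refine ⟨?_, Or.inl h⟩
      rintro rfl
      exact h1 (by simpa using h)
  have hmul : ∀ (f : G → ℝ) (u : G),
      ((cayleyGraph H).adjMatrix ℝ).mulVec f u = ∑ h with h ∈ H, f (h⁻¹ * u) := by
    intro f u
    rw [SimpleGraph.adjMatrix_mulVec_apply]
    refine Finset.sum_bij' (fun v _ => u * v⁻¹) (fun h _ => h⁻¹ * u) ?_ ?_ ?_ ?_ ?_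
    · intro v hv
      simpa [hadj] using hv
    · intro h hh
      simpa [hadj] using hh
    · simp
    · simp
    · simp
  have hspec : graphEigs (cayleyGraph H) = spectrum ℝ ((cayleyGraph H).adjMatrix ℝ) := by
    unfold graphEigs
    congr!
  rw [hspec, ← Matrix.spectrum_toLin', ← Module.End.hasEigenvalue_iff_mem_spectrum]
  constructor
  · intro h
    obtain ⟨f, hf⟩ := h.exists_hasEigenvector
    refine ⟨f, hf.2, fun u => ?_⟩
    have := congrFun hf.apply_eq_smul u
    rwa [Matrix.toLin'_apply, hmul] at this
  · rintro ⟨f, hf, h⟩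
    refine Module.End.hasEigenvalue_of_hasEigenvector (x := f)
      ⟨Module.End.mem_eigenspace_iff.2 ?_, hf⟩
    ext u
    rw [Matrix.toLin'_apply, hmul, h]
    rfl

/-- The sequence `0, 1, …, n - 1` in `Fin n`. -/
def finSeq (n : ℕ) [NeZero n] (k : ℕ) : Fin n := Fin.ofNat n k

lemma mem_initialSet_finSeq {n : ℕ} [NeZero n] {k : ℕ} (hk : k ≤ n) (i : Fin n) :
    i ∈ initialSet (finSeq n) k ↔ (i : ℕ) < k := by
  simp only [initialSet, Finset.mem_image, Finset.mem_range, finSeq]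
  constructor
  · rintro ⟨j, hj, rfl⟩
    rw [Fin.val_ofNat, Nat.mod_eq_of_lt (hj.trans_le hk)]
    exact hj
  · intro hi
    exact ⟨i, hi, Fin.ext (by rw [Fin.val_ofNat, Nat.mod_eq_of_lt i.2])⟩

lemma finSeq_notMem {n : ℕ} [NeZero n] {k : ℕ} (hk : k < n) :
    finSeq n k ∉ initialSet (finSeq n) k := by
  rw [mem_initialSet_finSeq hk.le, finSeq, Fin.val_ofNat, Nat.mod_eq_of_lt hk]
  exact lt_irrefl k

open Classical in
lemma sum_movingCycles {n : ℕ} [NeZero n] {r : ℕ} (hr : r ≤ n) {V : Type*} [AddCommGroup V] [Module ℝ V]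
    (ρ : Perm (Fin n) →* Module.End ℝ V) :
    ∑ g with g ∈ movingCycles n (r + 1) r, ρ g =
      ∑ x ∈ (initialSet (finSeq n) r)ᶜ, cycleSum ρ (insert x (initialSet (finSeq n) r)) := by
  set S := initialSet (finSeq n) r
  have hmem : ∀ i : Fin n, i ∈ S ↔ (i : ℕ) < r := mem_initialSet_finSeq hr
  have hcard : S.card = r := card_initialSet (r := r) (fun k hk => finSeq_notMem (by omega)) r le_rfl
  unfold cycleSum
  rw [← Finset.sum_biUnion]
  · refine Finset.sum_congr ?_ fun _ _ => rfl
    ext g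
    simp only [movingCycles, Set.mem_ofPred_eq, Finset.mem_filter, Finset.mem_univ, true_and,
      Finset.mem_biUnion, Finset.mem_compl, ← hmem]
    constructor
    · rintro ⟨hg, hc, hsub⟩
      obtain ⟨x, hx, heq⟩ := (Finset.covBy_iff_exists_insert).1
        (Finset.covBy_iff_card_sdiff_eq_one.2 ⟨hsub, by
          rw [Finset.card_sdiff_of_subset hsub, hc, hcard]; omega⟩)
      exact ⟨x, hx, hg, heq.symm⟩
    · rintro ⟨x, hx, hg, heq⟩
      refine ⟨hg, ?_, fun i hi => ?_⟩
      · rw [heq, Finset.card_insert_of_notMem hx, hcard]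
      · rw [heq]; exact Finset.mem_insert_of_mem hi
  · intro x hx y hy hxy
    refine Finset.disjoint_left.2 fun g hg hg' => hxy ?_
    simp only [Finset.mem_filter, Finset.mem_univ, true_and] at hg hg'
    rw [hg.2] at hg'
    have : x ∈ insert y S := hg'.2 ▸ Finset.mem_insert_self x S
    exact (Finset.mem_insert.1 this).resolve_right (Finset.mem_compl.1 hx)

lemma inv_mem_movingCycles {n k r : ℕ} {h : Perm (Fin n)} (hh : h ∈ movingCycles n k r) :
    h⁻¹ ∈ movingCycles n k r := by
  obtain ⟨h1, h2, h3⟩ := hh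
  exact ⟨h1.inv, by rwa [Perm.support_inv], by rwa [Perm.support_inv]⟩

lemma one_notMem_movingCycles {n k r : ℕ} : 1 ∉ movingCycles n k r :=
  fun h => h.1.ne_one rfl

open Classical in
lemma sum_movingCycles_apply {n : ℕ} [NeZero n] {r : ℕ} (hr : r ≤ n)
    (f : EuclideanSpace ℝ (Perm (Fin n))) (u : Perm (Fin n)) :
    ∑ h with h ∈ movingCycles n (r + 1) r, f (h⁻¹ * u) =
      (∑ x ∈ (initialSet (finSeq n) r)ᶜ,
        cycleSum (leftRegular (Fin n)) (insert x (initialSet (finSeq n) r))) f u := by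
  rw [← sum_movingCycles hr, LinearMap.sum_apply, WithLp.ofLp_sum, Finset.sum_apply]
  rfl

open Classical in
lemma movingCycles_eigenvalue {n r : ℕ} (hr : 2 ≤ r) (hrn : r + 2 ≤ n) {μ : ℝ}
    {f : Perm (Fin n) → ℝ} (hf : f ≠ 0)
    (h : ∀ u, ∑ h with h ∈ movingCycles n (r + 1) r, f (h⁻¹ * u) = μ * f u) :
    μ = ((r.factorial * (n - r) : ℕ) : ℝ) ∨ μ ≤ ((r.factorial * (n - r - 1) : ℕ) : ℝ) := by
  have : NeZero n := ⟨by omega⟩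
  have hp : ∀ k < r, finSeq n k ∉ initialSet (finSeq n) k := fun k hk => finSeq_notMem (by omega)
  have hm : (initialSet (finSeq n) r)ᶜ.card = n - r := by
    rw [Finset.card_compl, Fintype.card_fin, card_initialSet hp r le_rfl]
  have hne : WithLp.toLp 2 f ≠ 0 := fun h0 => hf ((WithLp.toLp_eq_zero 2).1 h0)
  have := cycleOperator_eigenvalue leftRegular_orthogonal hp hr hm (by omega) hne (μ := μ) (by
    ext u
    rw [← sum_movingCycles_apply (by omega)]
    exact h u)
  rw [Nat.cast_mul, Nat.cast_mul, Nat.cast_sub (by omega : 1 ≤ n - r), Nat.cast_one]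
  exact this

open Classical in
lemma exists_eigenfunction_movingCycles {n r : ℕ} (hr : 2 ≤ r) (hrn : r + 2 ≤ n) :
    (∃ f : Perm (Fin n) → ℝ, f 1 ≠ 0 ∧ ∀ u, ∑ h with h ∈ movingCycles n (r + 1) r, f (h⁻¹ * u) =
      ((r.factorial * (n - r) : ℕ) : ℝ) * f u) ∧
    (∃ f : Perm (Fin n) → ℝ, f 1 ≠ 0 ∧ ∀ u, ∑ h with h ∈ movingCycles n (r + 1) r, f (h⁻¹ * u) =
      ((r.factorial * (n - r - 1) : ℕ) : ℝ) * f u) := by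
  have : NeZero n := ⟨by omega⟩
  have hp : ∀ k < r, finSeq n k ∉ initialSet (finSeq n) k := fun k hk => finSeq_notMem (by omega)
  have hS : (initialSet (finSeq n) r).card = r := card_initialSet hp r le_rfl
  have hm : (initialSet (finSeq n) r)ᶜ.card = n - r := by
    rw [Finset.card_compl, Fintype.card_fin, hS]
  have hfac : (r.factorial : ℝ) = r * (r - 1).factorial := by
    rw [← Nat.mul_factorial_pred (by omega : r ≠ 0)]; push_cast; rfl
  have key : ∀ (f : EuclideanSpace ℝ (Perm (Fin n))) (t : ℝ),
      SwapFixed (leftRegular (Fin n)) (initialSet (finSeq n) r) f →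
      bipartiteSum (leftRegular (Fin n)) (initialSet (finSeq n) r) f = t • f → ∀ u,
      ∑ h with h ∈ movingCycles n (r + 1) r, f (h⁻¹ * u) = ((r - 1).factorial * t) * f u := by
    intro f t hf ht u
    rw [sum_movingCycles_apply (by omega), sum_cycleSum_insert _ (by omega), Module.End.mul_apply,
      hf.cycleSum_initialSet_apply hp hr, map_smul, ht, smul_smul]
    rfl
  constructor
  · let f : EuclideanSpace ℝ (Perm (Fin n)) := WithLp.toLp 2 fun _ => 1
    have hf : SwapFixed (leftRegular (Fin n)) Finset.univ f := fun _ _ _ _ => rfl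
    refine ⟨f, one_ne_zero, fun u => ?_⟩
    rw [key f _ (hf.mono _ (Finset.subset_univ _)) hf.bipartiteSum_apply, hS, hm, Nat.cast_mul, hfac]
    ring
  · let a : Fin n := ⟨r, by omega⟩
    let b : Fin n := ⟨r + 1, by omega⟩
    have hab : a ≠ b := fun h => by simpa [a, b] using congrArg Fin.val h
    have ha : a ∉ initialSet (finSeq n) r := by
      rw [mem_initialSet_finSeq (by omega)]; simp [a]
    have hb : b ∉ initialSet (finSeq n) r := by
      rw [mem_initialSet_finSeq (by omega)]; simp [b]
    let φ : Fin n → ℝ := fun z => (if z = a then 1 else 0) - (if z = b then 1 else 0)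
    have hφ : ∀ i ∈ initialSet (finSeq n) r, φ i = 0 := by
      intro i hi
      have h1 : i ≠ a := fun h => ha (h ▸ hi)
      have h2 : i ≠ b := fun h => hb (h ▸ hi)
      simp [φ, h1, h2]
    have hsum : ∑ x ∈ (initialSet (finSeq n) r)ᶜ, φ x = 0 := by
      simp only [φ, Finset.sum_sub_distrib, Finset.sum_ite_eq', Finset.mem_compl, ha, hb]
      simp
    refine ⟨evalFunction φ a, ?_, fun u => ?_⟩
    · simp [evalFunction_apply, φ, hab]
    · rw [key _ _ (swapFixed_evalFunction a hφ) (bipartiteSum_evalFunction a hφ hsum), hS, hm,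
        Nat.cast_mul, hfac, Nat.cast_sub (by omega : 1 ≤ n - r), Nat.cast_one]
      ring

lemma mem_alternatingGroup_of_mem_movingCycles {n r : ℕ} (hr : Even r) {h : Perm (Fin n)}
    (hh : h ∈ movingCycles n (r + 1) r) : h ∈ alternatingGroup (Fin n) := by
  rw [Perm.mem_alternatingGroup, hh.1.sign, hh.2.1, pow_succ, hr.neg_one_pow]
  simp

open Classical in
lemma sum_movingCyclesAlt {n r : ℕ} (hr : Even r) (F : Perm (Fin n) → ℝ)
    (u : alternatingGroup (Fin n)) :
    ∑ h with h ∈ movingCyclesAlt n (r + 1) r, F ((h⁻¹ * u : alternatingGroup (Fin n)) : Perm (Fin n))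
      = ∑ h with h ∈ movingCycles n (r + 1) r, F (h⁻¹ * u) := by
  refine Finset.sum_bij (fun h _ => (h : Perm (Fin n))) ?_ ?_ ?_ ?_
  · intro h hh
    rw [Finset.mem_filter] at hh ⊢
    exact ⟨Finset.mem_univ _, hh.2⟩
  · intro g _ h _ hgh
    exact Subtype.ext hgh
  · intro h hh
    have hh' := (Finset.mem_filter.1 hh).2
    exact ⟨⟨h, mem_alternatingGroup_of_mem_movingCycles hr hh'⟩,
      Finset.mem_filter.2 ⟨Finset.mem_univ _, hh'⟩, rfl⟩
  · intro h _
    rfl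

open Classical in
lemma movingCyclesAlt_eigenvalue {n r : ℕ} (hr : 2 ≤ r) (hrn : r + 2 ≤ n) (he : Even r) {μ : ℝ}
    {f : alternatingGroup (Fin n) → ℝ} (hf : f ≠ 0)
    (h : ∀ u, ∑ h with h ∈ movingCyclesAlt n (r + 1) r, f (h⁻¹ * u) = μ * f u) :
    μ = ((r.factorial * (n - r) : ℕ) : ℝ) ∨ μ ≤ ((r.factorial * (n - r - 1) : ℕ) : ℝ) := by
  let F : Perm (Fin n) → ℝ := fun u => if hu : u ∈ alternatingGroup (Fin n) then f ⟨u, hu⟩ else 0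
  have hFf : ∀ u : alternatingGroup (Fin n), F u = f u := fun u => dif_pos u.2
  refine movingCycles_eigenvalue hr hrn (f := F) ?_ fun u => ?_
  · intro h0
    exact hf (funext fun u => by rw [← hFf, h0]; rfl)
  · by_cases hu : u ∈ alternatingGroup (Fin n)
    · have h1 := sum_movingCyclesAlt he F ⟨u, hu⟩
      rw [← h1, hFf ⟨u, hu⟩, ← h]
      exact Finset.sum_congr rfl fun g _ => hFf _
    · have hFu : F u = 0 := dif_neg hu
      rw [hFu, mul_zero]
      refine Finset.sum_eq_zero fun g hg => dif_neg fun hc => hu ?_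
      have hg' := mem_alternatingGroup_of_mem_movingCycles he (Finset.mem_filter.1 hg).2
      simpa using Subgroup.mul_mem _ hg' hc

lemma isGreatest_and_isGreatest_lt {E : Set ℝ} {a b : ℝ} (hba : b < a) (ha : a ∈ E) (hb : b ∈ E)
    (h : ∀ μ ∈ E, μ = a ∨ μ ≤ b) : IsGreatest E a ∧ IsGreatest {μ | μ ∈ E ∧ μ < a} b := by
  refine ⟨⟨ha, fun μ hμ => ?_⟩, ⟨hb, hba⟩, fun μ hμ => ?_⟩
  · rcases h μ hμ with h | h <;> linarith
  · exact (h μ hμ.1).resolve_left hμ.2.ne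

end Graph

/-- Let `n > 4`, `2 ≤ r ≤ n-2`, `H = C(n,r+1;r)`, `G = S_n` for `r` odd and `G = A_n`
for `r` even, and `Γ = Cay(G,H)`.  Then `λ₁(Γ) = r!·(n-r)` and `λ₂(Γ) = r!·(n-r-1)`. -/
theorem stmt2 (n r : ℕ) (hn : 4 < n) (hr : 2 ≤ r) (hrn : r ≤ n - 2) :
    (Odd r →
      IsGreatest (graphEigs (cayleyGraph (movingCycles n (r + 1) r)))
        ((r.factorial * (n - r) : ℕ) : ℝ) ∧
      IsGreatest
        {μ : ℝ | μ ∈ graphEigs (cayleyGraph (movingCycles n (r + 1) r)) ∧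
          μ < ((r.factorial * (n - r) : ℕ) : ℝ)}
        ((r.factorial * (n - r - 1) : ℕ) : ℝ)) ∧
    (Even r →
      IsGreatest (graphEigs (cayleyGraph (movingCyclesAlt n (r + 1) r)))
        ((r.factorial * (n - r) : ℕ) : ℝ) ∧
      IsGreatest
        {μ : ℝ | μ ∈ graphEigs (cayleyGraph (movingCyclesAlt n (r + 1) r)) ∧
          μ < ((r.factorial * (n - r) : ℕ) : ℝ)}
        ((r.factorial * (n - r - 1) : ℕ) : ℝ)) := by
  classical
  have hrn' : r + 2 ≤ n := by omega
  have hlt : ((r.factorial * (n - r - 1) : ℕ) : ℝ) < ((r.factorial * (n - r) : ℕ) : ℝ) := by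
    exact_mod_cast Nat.mul_lt_mul_of_pos_left (by omega) r.factorial_pos
  obtain ⟨⟨f, hf, hfe⟩, ⟨g, hg, hge⟩⟩ := exists_eigenfunction_movingCycles hr hrn'
  refine ⟨fun _ => ?_, fun he => ?_⟩
  · have hmem := mem_graphEigs_cayleyGraph (one_notMem_movingCycles (n := n) (k := r + 1) (r := r))
      fun _ => inv_mem_movingCycles
    refine isGreatest_and_isGreatest_lt hlt ((hmem _).2 ⟨f, fun h => hf (congrFun h 1), hfe⟩)
      ((hmem _).2 ⟨g, fun h => hg (congrFun h 1), hge⟩) fun μ hμ => ?_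
    obtain ⟨w, hw, hwe⟩ := (hmem μ).1 hμ
    exact movingCycles_eigenvalue hr hrn' hw hwe
  · have hmem := mem_graphEigs_cayleyGraph (H := movingCyclesAlt n (r + 1) r)
      (one_notMem_movingCycles (n := n) (k := r + 1) (r := r))
      fun _ hh => inv_mem_movingCycles (n := n) (k := r + 1) (r := r) hh
    refine isGreatest_and_isGreatest_lt hlt
      ((hmem _).2 ⟨fun u => f u, fun h => hf (congrFun h 1), fun u => ?_⟩)
      ((hmem _).2 ⟨fun u => g u, fun h => hg (congrFun h 1), fun u => ?_⟩) fun μ hμ => ?_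
    · rw [sum_movingCyclesAlt he f u, hfe]
    · rw [sum_movingCyclesAlt he g u, hge]
    · obtain ⟨w, hw, hwe⟩ := (hmem μ).1 hμ
      exact movingCyclesAlt_eigenvalue hr hrn' he hw hwe
end

section
/- Let G = S_n, let M = ℂⁿ be the natural permutation module of G, and let F = Sym{1,…,k} × Sym{k+1,…,n} ⊆ G with 2 ≤ k ≤ n−2. Let H ⊆ G be a subset with xHx⁻¹ = H for all x ∈ F, and let A_H = Σ_{h∈H} P_h be the action of H⁺ on M. Then A_H has at most 4 distinct eigenvalues on M: there exist complex numbers μ₁, μ₂, μ₃, μ₄ (not necessarily distinct) such that the characteristic polynomial of A_H is (x−μ₁)(x−μ₂)(x−μ₃)^{k−1}(x−μ₄)^{n−k−1}. -/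
open Equiv Polynomial

namespace BlockConstant

/-- A matrix whose entries are invariant under simultaneous row and column transpositions inside
the fibres of `t` has off-diagonal entries depending only on the fibres of the indices. -/
lemma entry_eq_of_ne {ι κ R : Type*} [DecidableEq ι] {t : ι → κ} {A : Matrix ι ι R}
    (hA : ∀ a b, t a = t b → ∀ i j, A (swap a b i) (swap a b j) = A i j)
    {i j i' j' : ι} (hij : i ≠ j) (hij' : i' ≠ j') (hi : t i = t i') (hj : t j = t j') :
    A i j = A i' j' := by
  have ht : t (swap i i' j) = t j := by
    rw [swap_apply_def]
    split_ifs with h1 h2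
    · rw [h1, hi]
    · rw [h2, hi]
    · rfl
  have hne : i' ≠ swap i i' j := fun h => hij <| by
    apply (swap i i').injective
    rw [swap_apply_left, ← h]
  rw [← hA i i' hi i j, swap_apply_left, ← hA _ j' (ht.trans hj) i' (swap i i' j),
    swap_apply_left, swap_apply_of_ne_of_ne hne hij']

lemma entry_diag_eq {ι κ R : Type*} [DecidableEq ι] {t : ι → κ} {A : Matrix ι ι R}
    (hA : ∀ a b, t a = t b → ∀ i j, A (swap a b i) (swap a b j) = A i j)
    {i i' : ι} (hi : t i = t i') : A i i = A i' i' := by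
  rw [← hA i i' hi i i, swap_apply_left]

lemma det_diagonal_sub {ι κ K : Type*} [Fintype ι] [DecidableEq ι] [Fintype κ] [DecidableEq κ]
    [Field K] (t : ι → κ) (d : κ → K) (hd : ∀ s, d s ≠ 0) (B : Matrix κ κ K) :
    (Matrix.of fun i j => (if i = j then d (t i) else 0) - B (t i) (t j)).det =
      (∏ i, d (t i)) *
        (Matrix.of fun s s' => (if s = s' then 1 else 0) -
          (Finset.univ.filter (t · = s)).card * ((d s)⁻¹ * B s s')).det := by
  let U : Matrix ι κ K := Matrix.of fun i s => -B (t i) s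
  let V : Matrix κ ι K := Matrix.of fun s j => if t j = s then 1 else 0
  have hunit : IsUnit (Matrix.diagonal fun i => d (t i)).det := by
    rw [Matrix.det_diagonal, isUnit_iff_ne_zero]
    exact Finset.prod_ne_zero_iff.2 fun i _ => hd _
  have hinv : (Matrix.diagonal fun i => d (t i))⁻¹ = Matrix.diagonal fun i => (d (t i))⁻¹ := by
    apply Matrix.inv_eq_right_inv
    rw [Matrix.diagonal_mul_diagonal, ← Matrix.diagonal_one]
    congr 1
    ext i
    exact mul_inv_cancel₀ (hd _)
  have h := Matrix.det_add_mul (A := Matrix.diagonal fun i => d (t i)) U V hunit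
  rw [hinv, Matrix.det_diagonal] at h
  convert h using 2
  · ext i j
    simp [U, V, Matrix.mul_apply, Matrix.diagonal_apply, sub_eq_add_neg]
  · congr 1
    ext s s'
    rw [Matrix.add_apply, Matrix.mul_apply]
    simp only [Matrix.mul_diagonal, V, U, Matrix.of_apply, Matrix.one_apply, sub_eq_add_neg,
      ite_mul, one_mul, zero_mul]
    rw [← Finset.sum_filter, Finset.sum_congr rfl (g := fun _ => -((d s)⁻¹ * B s s'))]
    · simp
    · intro i hi
      rw [(Finset.mem_filter.1 hi).2, mul_neg]

/-- The characteristic polynomial of a matrix that is constant on the blocks of a partition into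
two nonempty parts, up to a scalar on the diagonal of each part. -/
lemma exists_charpoly_eq {ι : Type*} [Fintype ι] [DecidableEq ι] (t : ι → Fin 2) {p q : ℕ}
    (hp : (Finset.univ.filter (t · = 0)).card = p + 1)
    (hq : (Finset.univ.filter (t · = 1)).card = q + 1)
    (d : Fin 2 → ℂ) (B : Matrix (Fin 2) (Fin 2) ℂ) (A : Matrix ι ι ℂ)
    (hA : ∀ i j, A i j = (if i = j then d (t i) else 0) + B (t i) (t j)) :
    ∃ μ₁ μ₂ : ℂ, A.charpoly =
      (X - C μ₁) * (X - C μ₂) * (X - C (d 0)) ^ p * (X - C (d 1)) ^ q := by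
  let Q : Matrix (Fin 2) (Fin 2) ℂ :=
    !![d 0 + (p + 1) * B 0 0, (p + 1) * B 0 1; (q + 1) * B 1 0, d 1 + (q + 1) * B 1 1]
  obtain ⟨μ₁, μ₂, hμ⟩ : ∃ μ₁ μ₂ : ℂ, Q.charpoly = (X - C μ₁) * (X - C μ₂) := by
    have hs := (IsAlgClosed.splits Q.charpoly).eq_prod_roots_of_monic Q.charpoly_monic
    have hc : Q.charpoly.roots.card = 2 := by
      rw [← (IsAlgClosed.splits Q.charpoly).natDegree_eq_card_roots,
        Matrix.charpoly_natDegree_eq_dim, Fintype.card_fin]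
    obtain ⟨a, b, hab⟩ := Multiset.card_eq_two.1 hc
    exact ⟨a, b, by rw [hs, hab]; simp⟩
  refine ⟨μ₁, μ₂, ?_⟩
  rw [← hμ]
  apply Polynomial.eq_of_infinite_eval_eq
  refine Set.Infinite.mono ?_ (Set.toFinite {d 0, d 1}).infinite_compl
  intro x hx
  simp only [Set.mem_compl_iff, Set.mem_insert_iff, Set.mem_singleton_iff, not_or] at hx
  have h0 : x - d 0 ≠ 0 := sub_ne_zero.2 hx.1
  have h1 : x - d 1 ≠ 0 := sub_ne_zero.2 hx.2
  have hprod : ∏ i, (x - d (t i)) = (x - d 0) ^ (p + 1) * (x - d 1) ^ (q + 1) := by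
    rw [Finset.prod_comp (fun s => x - d s) t, Finset.prod_subset (Finset.subset_univ _),
      Fin.prod_univ_two, hp, hq]
    intro s _ hs
    rw [Finset.card_eq_zero.2, pow_zero]
    exact Finset.filter_eq_empty_iff.2 fun i _ hi =>
      hs (Finset.mem_image.2 ⟨i, Finset.mem_univ _, hi⟩)
  have hdet := det_diagonal_sub t (fun s => x - d s)
    (by simpa [Fin.forall_fin_two] using ⟨h0, h1⟩) B
  have hmat : Matrix.scalar ι x - A =
      Matrix.of fun i j => (if i = j then x - d (t i) else 0) - B (t i) (t j) := by
    ext i j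
    rw [Matrix.sub_apply, hA, Matrix.scalar_apply, Matrix.diagonal_apply, Matrix.of_apply]
    split_ifs <;> ring
  rw [Set.mem_ofPred_eq, Matrix.eval_charpoly, hmat, hdet, hprod, Matrix.det_fin_two]
  simp only [eval_mul, eval_pow, eval_sub, eval_X, eval_C, Matrix.eval_charpoly,
    Matrix.det_fin_two, Matrix.of_apply, hp, hq]
  simp [Q]
  field_simp
  ring

end BlockConstant

lemma sum_permMatrix_conj {ι : Type*} [DecidableEq ι] (H : Finset (Perm ι)) (σ : Perm ι)
    (h₁ : ∀ h ∈ H, σ * h * σ⁻¹ ∈ H) (h₂ : ∀ h ∈ H, σ⁻¹ * h * σ ∈ H) (i j : ι) :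
    (∑ h ∈ H, h.permMatrix ℂ) (σ i) (σ j) = (∑ h ∈ H, h.permMatrix ℂ) i j := by
  rw [Matrix.sum_apply, Matrix.sum_apply]
  refine Finset.sum_nbij' (σ⁻¹ * · * σ) (σ * · * σ⁻¹) h₂ h₁ (fun h _ => by group)
    (fun h _ => by group) fun h _ => ?_
  simp [Perm.permMatrix, PEquiv.toMatrix_apply, symm_apply_eq]

/-- Let `G = S_n`, `M = ℂⁿ` the natural permutation module, and
`F = Sym{1,…,k} × Sym{k+1,…,n}` with `2 ≤ k ≤ n-2`.  If `H ⊆ G` satisfies `xHx⁻¹ = H`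
for all `x ∈ F`, then the matrix `A_H = Σ_{h∈H} P_h` has at most 4 distinct eigenvalues
on `M`: its characteristic polynomial has the form
`(x-μ₁)(x-μ₂)(x-μ₃)^{k-1}(x-μ₄)^{n-k-1}`. -/
theorem stmt10 (n k : ℕ) (hk : 2 ≤ k) (hkn : k ≤ n - 2)
    (H : Finset (Perm (Fin n)))
    (hH : ∀ x : Perm (Fin n), (∀ i : Fin n, (i : ℕ) < k ↔ ((x i : ℕ) < k)) →
      ∀ h ∈ H, x * h * x⁻¹ ∈ H) :
    ∃ μ₁ μ₂ μ₃ μ₄ : ℂ,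
      (∑ h ∈ H, h.permMatrix ℂ).charpoly =
        (X - C μ₁) * (X - C μ₂) * (X - C μ₃) ^ (k - 1) * (X - C μ₄) ^ (n - k - 1) := by
  let t : Fin n → Fin 2 := fun i => if (i : ℕ) < k then 0 else 1
  have ht0 : ∀ i, t i = 0 ↔ (i : ℕ) < k := fun i => by simp [t]
  have ht1 : ∀ i, t i = 1 ↔ ¬ (i : ℕ) < k := fun i => by simp [t]
  set A : Matrix (Fin n) (Fin n) ℂ := ∑ h ∈ H, h.permMatrix ℂ with hAdef
  have hA : ∀ a b, t a = t b → ∀ i j, A (swap a b i) (swap a b j) = A i j := by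
    intro a b hab i j
    have hab' : (a : ℕ) < k ↔ (b : ℕ) < k := by rw [← ht0, ← ht0, hab]
    have hmem := hH (swap a b) fun i => by
      rw [swap_apply_def]
      split_ifs with h1 h2
      · rw [h1, hab']
      · rw [h2, hab']
      · rfl
    exact sum_permMatrix_conj H (swap a b) hmem (by simpa using hmem) i j
  have hcard0 : (Finset.univ.filter (t · = 0)).card = (k - 1) + 1 := by
    simp only [ht0]
    rw [Fin.card_filter_val_lt]
    omega
  have hcard1 : (Finset.univ.filter (t · = 1)).card = (n - k - 1) + 1 := by
    simp only [ht1]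
    have := Finset.card_filter_add_card_filter_not (s := (Finset.univ : Finset (Fin n)))
      (fun i => (i : ℕ) < k)
    rw [Fin.card_filter_val_lt, Finset.card_univ, Fintype.card_fin] at this
    omega
  let u : Fin 2 → Fin n := ![⟨0, by omega⟩, ⟨n - 2, by omega⟩]
  let v : Fin 2 → Fin n := ![⟨1, by omega⟩, ⟨n - 1, by omega⟩]
  have hu : ∀ s, t (u s) = s := by
    simp only [Fin.forall_fin_two, ht0, ht1, u, Matrix.cons_val_zero, Matrix.cons_val_one]
    omega
  have hv : ∀ s, t (v s) = s := by
    simp only [Fin.forall_fin_two, ht0, ht1, v, Matrix.cons_val_zero, Matrix.cons_val_one]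
    omega
  have huv : ∀ s s', u s ≠ v s' := by
    simp only [Fin.forall_fin_two, u, v, Matrix.cons_val_zero, Matrix.cons_val_one, ne_eq,
      Fin.mk.injEq]
    omega
  obtain ⟨μ₁, μ₂, h⟩ := BlockConstant.exists_charpoly_eq t hcard0 hcard1
    (fun s => A (u s) (u s) - A (u s) (v s)) (Matrix.of fun s s' => A (u s) (v s')) A
    (fun i j => by
      rw [Matrix.of_apply]
      split_ifs with hij
      · subst hij
        rw [sub_add_cancel]
        exact BlockConstant.entry_diag_eq hA (hu _).symm
      · rw [zero_add]
        exact BlockConstant.entry_eq_of_ne hA hij (huv _ _) (hu _).symm (hv _).symm)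
  exact ⟨μ₁, μ₂, _, _, h⟩
end
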